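/- arXiv:2307.06324 — 3 statements merged into one kernel-verified Lean document; each statement's English description precedes it below -/
import Mathlib

section
/- For any η ∈ (0,3), the two-step stepsize pattern h = (3−η, 3/2) is straightforward (i.e., 0-straightforward for some parameter Δ ∈ (0,1/2]). Consequently, for every convex L-smooth f : ℝ^n → ℝ with a minimizer x_⋆, every x_0 with D := sup{‖x − x_⋆‖₂ : f(x) ≤ f(x_0)} finite, and gradient descent with pattern h from x_0 (alternating stepsizes (3−η)/L and (3/2)/L), there exists a constant C ≥ 0 such that for every even T > 0, f(x_T) − f(x_⋆) ≤ L·D² / ((9/4 − η/2)·T) + C/T². -/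
open scoped BigOperators

noncomputable section

/-- `ℝ^n` with the Euclidean norm. -/
abbrev E (n : ℕ) : Type := EuclideanSpace ℝ (Fin n)

/-- A differentiable `f : ℝ^n → ℝ` is `L`-smooth if its gradient is `L`-Lipschitz. -/
def IsLSmooth {n : ℕ} (L : ℝ) (f : E n → ℝ) : Prop :=
  Differentiable ℝ f ∧ ∀ x y : E n, ‖gradient f x - gradient f y‖ ≤ L * ‖x - y‖

/-- A stepsize pattern `h` (of length `t`, given as the first `t` values of `h : ℕ → ℝ`)
is `ε`-straightforward with parameter `Δ`: for every dimension `n`, every `L, D > 0`,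
every `δ ∈ [0, L·D²·Δ]`, every convex `L`-smooth `g` with minimizer `ystar`, and every
initialization `y 0` with `‖y 0 - ystar‖ ≤ D` and `g (y 0) - g ystar ≤ δ`, one pass of
gradient descent through the pattern satisfies
`g (y t) - g ystar ≤ δ - (Σ_{i<t}(h i - ε)/(L·D²))·δ²`. -/
def IsStraightforward (t : ℕ) (h : ℕ → ℝ) (ε Δ : ℝ) : Prop :=
  ∀ (n : ℕ) (L D δ : ℝ), 0 < L → 0 < D → 0 ≤ δ → δ ≤ L * D ^ 2 * Δ →
    ∀ g : E n → ℝ, ConvexOn ℝ Set.univ g → IsLSmooth L g →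
      ∀ ystar : E n, (∀ z, g ystar ≤ g z) →
        ∀ y : ℕ → E n, ‖y 0 - ystar‖ ≤ D → g (y 0) - g ystar ≤ δ →
          (∀ k < t, y (k + 1) = y k - (h k / L) • gradient g (y k)) →
          g (y t) - g ystar ≤ δ - ((∑ i ∈ Finset.range t, (h i - ε)) / (L * D ^ 2)) * δ ^ 2



section helpers

variable {n : ℕ}

theorem aux_line (f : E n → ℝ) (hf : Differentiable ℝ f) (x v : E n) (t : ℝ) :
    HasDerivAt (fun t : ℝ => f (x + t • v)) (inner ℝ (gradient f (x + t • v)) v) t := by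
  have h1 := (hf (x + t • v)).hasGradientAt.hasFDerivAt
  have h2 : HasDerivAt (fun t : ℝ => x + t • v) v t := by
    simpa using ((hasDerivAt_id t).smul_const v).const_add x
  have := h1.comp_hasDerivAt t h2
  simp only [InnerProductSpace.toDual_apply_apply] at this
  exact this

theorem aux_convex (f : E n → ℝ) (hc : ConvexOn ℝ Set.univ f) (hf : Differentiable ℝ f)
    (x y : E n) : f y + inner ℝ (gradient f y) (x - y) ≤ f x := by
  have hl := aux_line f hf y (x - y) 0
  have hcl : ConvexOn ℝ Set.univ (fun t : ℝ => f (y + t • (x - y))) := by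
    refine ⟨convex_univ, ?_⟩
    intro a _ b _ p q hp hq hpq
    have := hc.2 (Set.mem_univ (y + a • (x - y))) (Set.mem_univ (y + b • (x - y))) hp hq hpq
    convert this using 2
    have e : y = p • y + q • y := by rw [← add_smul, hpq, one_smul]
    simp only [smul_eq_mul, smul_add, add_smul, mul_smul]
    nth_rewrite 1 [e]
    abel
  have := hcl.le_slope_of_hasDerivAt (Set.mem_univ 0) (Set.mem_univ 1) one_pos hl
  simp [slope_def_field] at this ⊢
  linarith

theorem aux_descent (f : E n → ℝ) (L : ℝ) (hs : IsLSmooth L f) (x v : E n) :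
    f (x + v) ≤ f x + inner ℝ (gradient f x) v + L / 2 * ‖v‖ ^ 2 := by
  obtain ⟨hf, hL⟩ := hs
  have hd : ∀ t : ℝ, HasDerivAt
      (fun t : ℝ => f (x + t • v) - t * inner ℝ (gradient f x) v - L / 2 * ‖v‖ ^ 2 * t ^ 2)
      (inner ℝ (gradient f (x + t • v)) v - inner ℝ (gradient f x) v - L * ‖v‖ ^ 2 * t) t := by
    intro t
    have h1 := aux_line f hf x v t
    have h2 := (hasDerivAt_id t).mul_const (inner ℝ (gradient f x) v)
    have h3 := (hasDerivAt_pow 2 t).const_mul (L / 2 * ‖v‖ ^ 2)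
    refine ((h1.sub h2).sub h3).congr_deriv ?_
    push_cast
    ring
  have ha := antitoneOn_of_deriv_nonpos (convex_Icc (0 : ℝ) 1)
    (fun t _ => (hd t).continuousAt.continuousWithinAt)
    (fun t _ => (hd t).differentiableAt.differentiableWithinAt)
    (by
      intro t ht
      rw [interior_Icc] at ht
      rw [(hd t).deriv, ← inner_sub_left]
      have h1 := real_inner_le_norm (gradient f (x + t • v) - gradient f x) v
      have h2 := hL (x + t • v) x
      rw [add_sub_cancel_left, norm_smul, Real.norm_of_nonneg ht.1.le] at h2
      have h3 := mul_le_mul_of_nonneg_right h2 (norm_nonneg v)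
      nlinarith)
  have := ha (Set.left_mem_Icc.2 zero_le_one) (Set.right_mem_Icc.2 zero_le_one) zero_le_one
  simp at this ⊢
  linarith

theorem aux_coco (f : E n → ℝ) (L : ℝ) (hL : 0 < L) (hc : ConvexOn ℝ Set.univ f)
    (hs : IsLSmooth L f) (x y : E n) :
    f y + inner ℝ (gradient f y) (x - y) + 1 / (2 * L) * ‖gradient f x - gradient f y‖ ^ 2
      ≤ f x := by
  set d := gradient f x - gradient f y with hd
  have h1 := aux_descent f L hs x (-(1 / L) • d)
  have h2 := aux_convex f hc hs.1 (x + (-(1 / L) • d)) y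
  have e1 : x + (-(1 / L) • d) - y = (x - y) + (-(1 / L) • d) := by abel
  rw [e1, inner_add_right, real_inner_smul_right] at h2
  rw [real_inner_smul_right, norm_smul, mul_pow] at h1
  have e2 : inner ℝ (gradient f x) d = inner ℝ (gradient f y) d + ‖d‖ ^ 2 := by
    rw [← real_inner_self_eq_norm_sq, ← inner_add_left, hd]; simp
  rw [e2] at h1
  have e3 : L / 2 * (‖-(1 / L)‖ ^ 2 * ‖d‖ ^ 2) = 1 / (2 * L) * ‖d‖ ^ 2 := by
    rw [Real.norm_eq_abs, sq_abs]; field_simp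
  rw [e3] at h1
  have e4 : 1 / L * ‖d‖ ^ 2 = 2 * (1 / (2 * L) * ‖d‖ ^ 2) := by field_simp
  nlinarith

/-- Normalized interpolation inequality. -/
theorem aux_coco' (f : E n → ℝ) (L : ℝ) (hL : 0 < L) (hc : ConvexOn ℝ Set.univ f)
    (hs : IsLSmooth L f) (x y : E n) (c : ℝ) :
    (f y - c) / L + inner ℝ ((1 / L) • gradient f y) (x - y)
      + 1 / 2 * ‖(1 / L) • gradient f x - (1 / L) • gradient f y‖ ^ 2
      ≤ (f x - c) / L := by
  have h := aux_coco f L hL hc hs x y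
  rw [← smul_sub, norm_smul, mul_pow, real_inner_smul_left, Real.norm_eq_abs, sq_abs]
  rw [le_div_iff₀ hL]
  have : ((f y - c) / L + 1 / L * inner ℝ (gradient f y) (x - y) +
      1 / 2 * ((1 / L) ^ 2 * ‖gradient f x - gradient f y‖ ^ 2)) * L =
      f y - c + inner ℝ (gradient f y) (x - y)
        + 1 / (2 * L) * ‖gradient f x - gradient f y‖ ^ 2 := by
    field_simp
  rw [this]
  linarith

set_option maxHeartbeats 2000000 in
theorem aux_core {V : Type*} [NormedAddCommGroup V] [InnerProductSpace ℝ V]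
    (u θ d : ℝ) (hu0 : 0 < u) (hu3 : u < 3) (hθ : 8 * (2 * u + 3) * θ = (3 - u) * (u + 1))
    (hd0 : 0 ≤ d) (hd : d ≤ θ / 500)
    (X g0 g1 g2 : V) (F0 F1 F2 : ℝ)
    (Q01 : F1 + inner ℝ g1 (u • g0) + 1 / 2 * ‖g0 - g1‖ ^ 2 ≤ F0)
    (Q12 : F2 + inner ℝ g2 ((3 / 2 : ℝ) • g1) + 1 / 2 * ‖g1 - g2‖ ^ 2 ≤ F1)
    (Q02 : F2 + inner ℝ g2 (u • g0 + (3 / 2 : ℝ) • g1) + 1 / 2 * ‖g0 - g2‖ ^ 2 ≤ F0)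
    (S0 : F0 + inner ℝ g0 (-X) + 1 / 2 * ‖g0‖ ^ 2 ≤ 0)
    (S1 : F1 + inner ℝ g1 (-(X - u • g0)) + 1 / 2 * ‖g1‖ ^ 2 ≤ 0)
    (S2 : F2 + inner ℝ g2 (-(X - u • g0 - (3 / 2 : ℝ) • g1)) + 1 / 2 * ‖g2‖ ^ 2 ≤ 0) :
    F2 ≤ (1 - (2 * u + 3) * d) * F0 + (u + 3 / 2) * d ^ 2 * ‖X‖ ^ 2 := by
  obtain ⟨s, hs⟩ : ∃ s, s = g0 - g1 := ⟨_, rfl⟩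
  obtain ⟨t, ht⟩ : ∃ t, t = g1 - g2 := ⟨_, rfl⟩
  have hg1 : g1 = g0 - s := by rw [hs]; abel
  have hg2 : g2 = g0 - s - t := by rw [hs, ht]; abel
  clear hs ht
  subst hg1
  subst hg2
  have hw : 0 < 2 * u + 3 := by linarith
  have hθ0 : 0 < θ := by
    by_contra hcon
    nlinarith [mul_pos (sub_pos.2 hu3) (by linarith : (0 : ℝ) < u + 1)]
  have hθ1 : θ ≤ 1 / 8 := by
    by_contra hcon
    nlinarith
  -- the parameters
  obtain ⟨α, hα⟩ : ∃ α, α = (u ^ 2 + u - 3) / (2 * (2 * u + 3)) := ⟨_, rfl⟩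
  have hα' : α * (2 * (2 * u + 3)) = u ^ 2 + u - 3 := by rw [hα]; field_simp
  obtain ⟨β, hβ⟩ : ∃ β, β = u ^ 2 * θ / (2 * (2 * u + 3)) := ⟨_, rfl⟩
  have hα1 : α ≤ 1 / 2 := by rw [hα, div_le_iff₀ (by linarith)]; nlinarith
  have hα2 : -(1 / 2) ≤ α := by rw [hα, le_div_iff₀ (by linarith)]; nlinarith
  have hβ1 : β ≤ 1 / 16 := by
    rw [hβ, div_le_iff₀ (by linarith)]
    have : u ^ 2 * θ ≤ u ^ 2 * (1 / 8) := by gcongr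
    nlinarith
  obtain ⟨m, hm⟩ : ∃ m, m = (u + 3) / 2 - u * θ := ⟨_, rfl⟩
  have hm0 : 0 ≤ m := by rw [hm]; nlinarith
  have hm3 : m ≤ 3 := by rw [hm]; nlinarith
  -- nonnegativity of squares
  have P1 : 0 ≤ ‖d • X - (1 / (2 * u + 3)) •
      (u • g0 + (u + 3 - m) • (g0 - s) + m • (g0 - s - t))‖ ^ 2 := by positivity
  have P2 : 0 ≤ ‖s + ((2 + α) / (39 / 10)) • t‖ ^ 2 := by positivity
  have P3 : 0 ≤ ‖g0 - (2 * (u + 3) / (2 * u + 3)) • s‖ ^ 2 := by positivity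
  have P4 : 0 ≤ ‖g0 - (2 * (m * (u + 1)) / (2 * u + 3)) • t‖ ^ 2 := by positivity
  have P5 : 0 ≤ ‖s + t‖ ^ 2 := by positivity
  have PS : 0 ≤ ‖s‖ ^ 2 := by positivity
  have PT : 0 ≤ ‖t‖ ^ 2 := by positivity
  simp only [← real_inner_self_eq_norm_sq, inner_add_left, inner_add_right, inner_sub_left,
    inner_sub_right, inner_neg_right, real_inner_smul_left, real_inner_smul_right] at *
  simp only [real_inner_comm X g0, real_inner_comm X s, real_inner_comm X t,
    real_inner_comm g0 s, real_inner_comm g0 t, real_inner_comm s t] at *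
  generalize inner ℝ X X = XX at *
  generalize inner ℝ X g0 = XG at *
  generalize inner ℝ X s = XS at *
  generalize inner ℝ X t = XT at *
  generalize inner ℝ g0 g0 = A at *
  generalize inner ℝ g0 s = B at *
  generalize inner ℝ g0 t = C at *
  generalize inner ℝ s s = S at *
  generalize inner ℝ s t = R at *
  generalize inner ℝ t t = T at *
  have q01 : F1 + u * (A - B) + S / 2 ≤ F0 := by linarith
  have q12 : F2 + 3 / 2 * (A - 2 * B + S - C + R) + T / 2 ≤ F1 := by linarith
  have q02 : F2 + u * (A - B - C) + 3 / 2 * (A - 2 * B + S - C + R) + (S + 2 * R + T) / 2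
      ≤ F0 := by linarith
  have s0 : F0 - XG + A / 2 ≤ 0 := by linarith
  have s1 : F1 - XG + XS + u * (A - B) + (A - 2 * B + S) / 2 ≤ 0 := by linarith
  have s2 : F2 - XG + XS + XT + u * (A - B - C) + 3 / 2 * (A - 2 * B + S - C + R)
      + (A - 2 * B + S - 2 * C + 2 * R + T) / 2 ≤ 0 := by linarith
  obtain ⟨K, hK⟩ : ∃ K, K = ((2 * u + 3) ^ 2 * A + (u + 3) ^ 2 * S + m ^ 2 * T
      - 2 * (2 * u + 3) * (u + 3) * B - 2 * (2 * u + 3) * m * C + 2 * (u + 3) * m * R)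
      / (2 * (2 * u + 3)) := ⟨_, rfl⟩
  have p1 : 0 ≤ (u + 3 / 2) * d ^ 2 * XX - d * ((2 * u + 3) * XG - (u + 3) * XS - m * XT) + K := by
    have := mul_nonneg (by linarith : 0 ≤ u + 3 / 2) P1
    refine this.trans_eq ?_
    rw [hK]
    field_simp
    ring
  have hM0 : (1 / 2 + θ) * (u * (A - B) + S / 2)
      + (1 / 2 + θ) * (3 / 2 * (A - 2 * B + S - C + R) + T / 2)
      + (1 / 2 - θ) * (u * (A - B - C) + 3 / 2 * (A - 2 * B + S - C + R) + (S + 2 * R + T) / 2) - K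
      = θ * ((2 - α) * S - (1 / 2 + β) * T + (2 + α) * (S + 2 * R + T)) := by
    have hθe : θ = (3 - u) * (u + 1) / (8 * (2 * u + 3)) := by
      rw [eq_div_iff (by positivity)]; linarith
    rw [hK, hm, hα, hβ, hθe]
    field_simp
    ring
  have hM0' : 1 / 10 * (S + T) ≤ (2 - α) * S - (1 / 2 + β) * T + (2 + α) * (S + 2 * R + T) := by
    have h1 : 0 ≤ (7 / 5 + α - β - (2 + α) ^ 2 / (39 / 10)) * T := by
      refine mul_nonneg ?_ PT
      nlinarith only [hα1, hα2, hβ1]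
    linarith
  have hM1 : -50 * (S + T) ≤ (u + 3 / 2) * A - (u + 3) * B - m * (u + 1) * C + m * R := by
    have h3 := mul_nonneg (by linarith : 0 ≤ (2 * u + 3) / 4) P3
    have h4 := mul_nonneg (by linarith : 0 ≤ (2 * u + 3) / 4) P4
    have e3 : (2 * u + 3) / 4 * (A - 2 * (u + 3) / (2 * u + 3) * B -
      (2 * (u + 3) / (2 * u + 3) * B - 2 * (u + 3) / (2 * u + 3) * (2 * (u + 3) / (2 * u + 3) * S)))
      = (2 * u + 3) / 4 * A - (u + 3) * B + (u + 3) ^ 2 / (2 * u + 3) * S := by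
      field_simp
      ring
    have e4 : (2 * u + 3) / 4 * (A - 2 * (m * (u + 1)) / (2 * u + 3) * C -
      (2 * (m * (u + 1)) / (2 * u + 3) * C - 2 * (m * (u + 1)) / (2 * u + 3) *
        (2 * (m * (u + 1)) / (2 * u + 3) * T)))
      = (2 * u + 3) / 4 * A - m * (u + 1) * C + (m * (u + 1)) ^ 2 / (2 * u + 3) * T := by
      field_simp
      ring
    rw [e3] at h3
    rw [e4] at h4
    have b3 : (u + 3) ^ 2 / (2 * u + 3) * S ≤ 12 * S := by
      refine mul_le_mul_of_nonneg_right ?_ PS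
      rw [div_le_iff₀ hw]; nlinarith only [hu0, hu3]
    have b4 : (m * (u + 1)) ^ 2 / (2 * u + 3) * T ≤ 48 * T := by
      refine mul_le_mul_of_nonneg_right ?_ PT
      have h5 : m * (u + 1) ≤ 12 := by nlinarith only [hu0, hu3, hm0, hm3]
      have h6 : 0 ≤ m * (u + 1) := by positivity
      rw [div_le_iff₀ hw]; nlinarith only [h5, h6, hu0]
    have h7 := mul_nonneg hm0 P5
    have h8 : m * (S + T) ≤ 3 * (S + T) := by gcongr
    linarith
  have hdm : d * m ≤ d * 3 := by gcongr
  have hdu : d * u ≤ d * 3 := by gcongr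
  have r1 := mul_le_mul_of_nonneg_left q01 (by linarith : 0 ≤ 1 / 2 + θ - d * (u + 3))
  have r2 := mul_le_mul_of_nonneg_left q12 (by linarith : 0 ≤ 1 / 2 + θ - d * m)
  have r3 := mul_le_mul_of_nonneg_left q02 (by linarith : 0 ≤ 1 / 2 - θ)
  have r4 := mul_le_mul_of_nonneg_left s0 (by positivity : 0 ≤ d * u)
  have r5 := mul_le_mul_of_nonneg_left s1 (mul_nonneg hd0 (by linarith) : 0 ≤ d * (u + 3 - m))
  have r6 := mul_le_mul_of_nonneg_left s2 (by positivity : 0 ≤ d * m)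
  have r7 := mul_le_mul_of_nonneg_left hM0' hθ0.le
  have r8 := mul_le_mul_of_nonneg_left hM1 hd0
  have r9 := mul_le_mul_of_nonneg_right hd (by linarith : 0 ≤ S + T)
  rw [← hM0] at r7
  linarith only [r1, r2, r3, r4, r5, r6, r7, r8, r9, p1]

theorem aux_straight (η : ℝ) (hη0 : 0 < η) (hη3 : η < 3)
    (h : ℕ → ℝ) (hdef : h = fun k => if k % 2 = 0 then 3 - η else 3 / 2) :
    ∃ Δ : ℝ, 0 < Δ ∧ Δ ≤ 1 / 2 ∧ IsStraightforward 2 h 0 Δ := by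
  obtain ⟨u, hu⟩ : ∃ u, u = 3 - η := ⟨_, rfl⟩
  have hu0 : 0 < u := by linarith
  have hu3 : u < 3 := by linarith
  obtain ⟨θ, hθ⟩ : ∃ θ, θ = (3 - u) * (u + 1) / (8 * (2 * u + 3)) := ⟨_, rfl⟩
  have hθ0 : 0 < θ := by
    rw [hθ]
    have : 0 < 3 - u := by linarith
    positivity
  have hθ' : 8 * (2 * u + 3) * θ = (3 - u) * (u + 1) := by rw [hθ]; field_simp
  have hθ1 : θ ≤ 1 / 8 := by
    by_contra hcon
    nlinarith
  refine ⟨θ / 500, by positivity, by linarith, ?_⟩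
  intro n L D δ hL hD hδ0 hδ g hc hs ystar hmin y hy0 hg0 hy
  have h0 : h 0 = u := by simp [hdef, hu]
  have h1 : h 1 = 3 / 2 := by simp [hdef]
  have hy1 := hy 0 (by norm_num)
  have hy2 := hy 1 (by norm_num)
  rw [h0] at hy1
  rw [h1] at hy2
  norm_num at hy1 hy2
  have hgs : gradient g ystar = 0 := by
    have : IsLocalMin g ystar := Filter.Eventually.of_forall hmin
    rw [gradient, this.fderiv_eq_zero, map_zero]
  set G := fun k => (1 / L) • gradient g (y k) with hG
  have e1 : y 0 - y 1 = u • G 0 := by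
    rw [hy1, hG]; simp [smul_smul, div_eq_mul_inv]
  have e2 : y 1 - y 2 = (3 / 2 : ℝ) • G 1 := by
    rw [hy2, hG]; simp [smul_smul, div_eq_mul_inv]
  have e02 : y 0 - y 2 = u • G 0 + (3 / 2 : ℝ) • G 1 := by rw [← e1, ← e2]; abel
  have es0 : ystar - y 0 = -(y 0 - ystar) := by abel
  have es1 : ystar - y 1 = -((y 0 - ystar) - u • G 0) := by rw [← e1]; abel
  have es2 : ystar - y 2 = -((y 0 - ystar) - u • G 0 - (3 / 2 : ℝ) • G 1) := by
    rw [← e1, ← e2]; abel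
  have Q : ∀ i j, (g (y j) - g ystar) / L + inner ℝ (G j) (y i - y j)
      + 1 / 2 * ‖G i - G j‖ ^ 2 ≤ (g (y i) - g ystar) / L :=
    fun i j => aux_coco' g L hL hc hs (y i) (y j) (g ystar)
  have QS : ∀ j, (g (y j) - g ystar) / L + inner ℝ (G j) (ystar - y j)
      + 1 / 2 * ‖G j‖ ^ 2 ≤ 0 := by
    intro j
    have := aux_coco' g L hL hc hs ystar (y j) (g ystar)
    rw [hgs, smul_zero, zero_sub, norm_neg, sub_self, zero_div] at this
    exact this
  have hLD : 0 < L * D ^ 2 := by positivity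
  obtain ⟨d, hd⟩ : ∃ d, d = δ / (L * D ^ 2) := ⟨_, rfl⟩
  have hd0 : 0 ≤ d := by rw [hd]; positivity
  have hd1 : d ≤ θ / 500 := by rw [hd, div_le_iff₀ hLD]; linarith
  have hδd : δ = d * (L * D ^ 2) := by rw [hd]; field_simp
  have core := aux_core u θ d hu0 hu3 hθ' hd0 hd1 (y 0 - ystar) (G 0) (G 1) (G 2)
    ((g (y 0) - g ystar) / L) ((g (y 1) - g ystar) / L) ((g (y 2) - g ystar) / L)
    (by rw [← e1]; exact Q 0 1) (by rw [← e2]; exact Q 1 2) (by rw [← e02]; exact Q 0 2)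
    (by rw [← es0]; exact QS 0) (by rw [← es1]; exact QS 1) (by rw [← es2]; exact QS 2)
  have hF0 : (g (y 0) - g ystar) / L ≤ d * D ^ 2 := by
    rw [div_le_iff₀ hL]; linarith
  have hX : ‖y 0 - ystar‖ ^ 2 ≤ D ^ 2 := by gcongr
  have c1 : (1 - (2 * u + 3) * d) * ((g (y 0) - g ystar) / L)
      ≤ (1 - (2 * u + 3) * d) * (d * D ^ 2) := by
    refine mul_le_mul_of_nonneg_left hF0 ?_
    have : u * d ≤ 3 * d := by gcongr
    linarith
  have c2 : (u + 3 / 2) * d ^ 2 * ‖y 0 - ystar‖ ^ 2 ≤ (u + 3 / 2) * d ^ 2 * D ^ 2 := by gcongr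
  have c3 : (g (y 2) - g ystar) / L ≤ d * D ^ 2 - (u + 3 / 2) * d ^ 2 * D ^ 2 := by linarith
  rw [div_le_iff₀ hL] at c3
  refine c3.trans_eq ?_
  simp only [Finset.sum_range_succ, Finset.sum_range_zero, h0, h1, hδd]
  field_simp
  ring

theorem aux_seq (a : ℕ → ℝ) (c : ℝ) (hc : 0 < c) (ha : ∀ k, 0 ≤ a k)
    (hr : ∀ k, a (k + 1) ≤ a k - c * a k ^ 2) (k : ℕ) : a k * (c * k) ≤ 1 := by
  induction k with
  | zero => simp
  | succ k ih =>
    have h1 := hr k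
    have h2 := ha (k + 1)
    have h3 := ha k
    have hk : (0 : ℝ) ≤ k := Nat.cast_nonneg k
    have h4 : c * a k ≤ 1 := by
      by_contra hcon
      push Not at hcon
      have : 0 < a k := by
        by_contra h0
        have : a k = 0 := by linarith
        rw [this] at hcon
        linarith
      nlinarith
    push_cast
    have h5 : a (k + 1) * (c * (k + 1)) ≤ (a k - c * a k ^ 2) * (c * (k + 1)) := by gcongr
    have h6 := mul_nonneg (sub_nonneg.2 ih) (sub_nonneg.2 h4)
    nlinarith [sq_nonneg (c * a k)]

end helpers

/-- Theorem 3.4: for any `η ∈ (0,3)`, the two-step pattern `h = (3-η, 3/2)` is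
straightforward (0-straightforward for some `Δ ∈ (0,1/2]`); consequently gradient
descent alternating stepsizes `(3-η)/L` and `(3/2)/L` satisfies
`f (x T) - f x⋆ ≤ L D² / ((9/4 - η/2) T) + C/T²` for all even `T > 0`. -/
theorem two_step_pattern_rate (η : ℝ) (hη0 : 0 < η) (hη3 : η < 3)
    (h : ℕ → ℝ) (hdef : h = fun k => if k % 2 = 0 then 3 - η else 3 / 2) :
    (∃ Δ : ℝ, 0 < Δ ∧ Δ ≤ 1 / 2 ∧ IsStraightforward 2 h 0 Δ)
    ∧ (∀ (n : ℕ) (L : ℝ), 0 < L →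
        ∀ f : E n → ℝ, ConvexOn ℝ Set.univ f → IsLSmooth L f →
          ∀ xstar : E n, (∀ z, f xstar ≤ f z) →
            ∀ (x : ℕ → E n) (x0 : E n), x 0 = x0 →
              ∀ D : ℝ, IsLUB {r : ℝ | ∃ z : E n, f z ≤ f x0 ∧ r = ‖z - xstar‖} D →
                (∀ k : ℕ, x (k + 1) = x k - (h (k % 2) / L) • gradient f (x k)) →
                ∃ C : ℝ, 0 ≤ C ∧ ∀ T : ℕ, 0 < T → 2 ∣ T →
                  f (x T) - f xstar ≤
                    L * D ^ 2 / ((9 / 4 - η / 2) * T) + C / (T : ℝ) ^ 2) := by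
  refine ⟨aux_straight η hη0 hη3 h hdef, ?_⟩
  obtain ⟨Δ, hΔ0, hΔ1, hst⟩ := aux_straight η hη0 hη3 h hdef
  intro n L hL f hc hs xstar hmin x x0 hx0 D hD hx
  have hsum : ∑ i ∈ Finset.range 2, (h i - 0) = 9 / 2 - η := by
    simp [Finset.sum_range_succ, hdef]
    ring
  have hD0 : ‖x0 - xstar‖ ≤ D := hD.1 ⟨x0, le_rfl, rfl⟩
  have hDnn : 0 ≤ D := (norm_nonneg _).trans hD0
  obtain ⟨a, ha⟩ : ∃ a : ℕ → ℝ, a = fun k => f (x (2 * k)) - f xstar := ⟨_, rfl⟩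
  have hann : ∀ k, 0 ≤ a k := fun k => by rw [ha]; simpa using hmin (x (2 * k))
  have hσ : 0 < 9 / 2 - η := by linarith
  -- one pass
  have step : ∀ R : ℝ, 0 < R → ∀ k, ‖x (2 * k) - xstar‖ ≤ R → a k ≤ L * R ^ 2 * Δ →
      a (k + 1) ≤ a k - (9 / 2 - η) / (L * R ^ 2) * a k ^ 2 := by
    intro R hR k hk hak
    have := hst n L R (a k) hL hR (hann k) hak f hc hs xstar hmin (fun j => x (2 * k + j)) hk
      (by rw [ha]; rfl)
      (by
        intro j hj
        have h1 := hx (2 * k + j)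
        have h2 : (2 * k + j) % 2 = j := by omega
        rw [h2] at h1
        exact h1)
    rw [hsum] at this
    rw [ha] at this ⊢
    exact this
  have hball : ∀ k, a k ≤ a 0 → ‖x (2 * k) - xstar‖ ≤ D := by
    intro k hk
    refine hD.1 ⟨x (2 * k), ?_, rfl⟩
    rw [ha] at hk
    simp [hx0] at hk
    exact hk
  obtain ⟨R, hR⟩ : ∃ R, R = D + 1 + a 0 / (L * Δ) := ⟨_, rfl⟩
  have hpos : 0 ≤ a 0 / (L * Δ) := div_nonneg (hann 0) (by positivity)
  have hR1 : 1 ≤ R := by linarith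
  have hRD : D ≤ R := by linarith
  have hR0 : 0 < R := by linarith
  have hRa : a 0 ≤ L * R ^ 2 * Δ := by
    have h1 : a 0 / (L * Δ) ≤ R ^ 2 := by nlinarith
    rw [div_le_iff₀ (by positivity)] at h1
    linarith
  obtain ⟨c', hc'⟩ : ∃ c', c' = (9 / 2 - η) / (L * R ^ 2) := ⟨_, rfl⟩
  have hc'0 : 0 < c' := by rw [hc']; positivity
  have mono : ∀ k, a k ≤ a 0 := by
    intro k
    induction k with
    | zero => exact le_rfl
    | succ k ih =>
      have := step R hR0 k ((hball k ih).trans hRD) (ih.trans hRa)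
      rw [← hc'] at this
      have h2 : 0 ≤ c' * a k ^ 2 := by positivity
      linarith
  have rec1 : ∀ k, a (k + 1) ≤ a k - c' * a k ^ 2 := fun k => by
    rw [hc']
    exact step R hR0 k ((hball k (mono k)).trans hRD) ((mono k).trans hRa)
  have rate1 := aux_seq a c' hc'0 hann rec1
  rcases hDnn.eq_or_lt with hDz | hDpos
  · refine ⟨0, le_rfl, ?_⟩
    intro T hT hT2
    obtain ⟨k, rfl⟩ := hT2
    have h1 : x0 = xstar := by
      rw [← hDz] at hD0
      exact sub_eq_zero.1 (norm_le_zero_iff.1 hD0)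
    have h2 : a 0 = 0 := by rw [ha]; simp [hx0, h1]
    have h3 := mono k
    rw [h2, ha] at h3
    simp only [← hDz]
    simpa using h3
  obtain ⟨c, hcd⟩ : ∃ c, c = (9 / 2 - η) / (L * D ^ 2) := ⟨_, rfl⟩
  have hc0 : 0 < c := by rw [hcd]; positivity
  have hB : 0 < L * D ^ 2 * Δ := by positivity
  obtain ⟨N, hN⟩ := exists_nat_gt (1 / (c' * (L * D ^ 2 * Δ)))
  have hsmall : ∀ k, N ≤ k → a k ≤ L * D ^ 2 * Δ := by
    intro k hk
    have hk' : (N : ℝ) ≤ k := by exact_mod_cast hk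
    have h1 := rate1 k
    rw [div_lt_iff₀ (by positivity)] at hN
    by_contra hcon
    push Not at hcon
    have hNpos : (0 : ℝ) < k := by
      by_contra h0
      have h00 : (N : ℝ) ≤ 0 := by linarith
      nlinarith [mul_pos hc'0 hB]
    have h2 : L * D ^ 2 * Δ * (c' * k) ≤ a k * (c' * k) := by gcongr
    have h3 : (N : ℝ) * (c' * (L * D ^ 2 * Δ)) ≤ k * (c' * (L * D ^ 2 * Δ)) := by gcongr
    linarith
  have rate2 := aux_seq (fun j => a (N + j)) c hc0 (fun j => hann _) (fun j => by
    rw [hcd]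
    exact step D hDpos (N + j) (hball _ (mono _)) (hsmall _ (by omega)))
  refine ⟨4 * (N / c'), by positivity, ?_⟩
  intro T hT hT2
  obtain ⟨k, rfl⟩ := hT2
  have hk : (0 : ℝ) < k := by
    have : 0 < k := by omega
    exact_mod_cast this
  have e1 : L * D ^ 2 / ((9 / 4 - η / 2) * ((2 * k : ℕ) : ℝ)) = 1 / (c * k) := by
    rw [hcd]
    push_cast
    have : (9 / 4 - η / 2) * (2 * (k : ℝ)) = (9 / 2 - η) * k := by ring
    rw [this]
    field_simp
  have e2 : 4 * (N / c') / (((2 * k : ℕ) : ℝ)) ^ 2 = N / c' / (k : ℝ) ^ 2 := by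
    push_cast
    field_simp
    ring
  rw [e1, e2]
  have h1 := rate1 k
  have goal' : a k ≤ 1 / (c * k) + N / c' / (k : ℝ) ^ 2 := by
    have hak : a k ≤ 1 / (c' * k) := by rw [le_div_iff₀ (by positivity)]; exact h1
    have hNk : (N : ℝ) / k * (1 / (c' * k)) = N / c' / (k : ℝ) ^ 2 := by field_simp
    rw [← hNk]
    rcases le_total N k with hle | hle
    · obtain ⟨j, rfl⟩ := Nat.exists_eq_add_of_le hle
      have h2 := rate2 j
      have h3 : (N : ℝ) / (N + j : ℕ) * a (N + j) ≤
          (N : ℝ) / (N + j : ℕ) * (1 / (c' * (N + j : ℕ))) := by gcongr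
      have h4 : a (N + j) - (N : ℝ) / (N + j : ℕ) * a (N + j) ≤ 1 / (c * (N + j : ℕ)) := by
        rw [le_div_iff₀ (by positivity)]
        refine le_trans (le_of_eq ?_) h2
        field_simp
        push_cast
        ring
      linarith
    · have hle' : (k : ℝ) ≤ N := by exact_mod_cast hle
      have h2 : 1 ≤ (N : ℝ) / k := by rw [le_div_iff₀ hk]; linarith
      have h3 : 0 ≤ 1 / (c' * k) := by positivity
      have h4 : 0 ≤ 1 / (c * k) := by positivity
      nlinarith
  rw [ha] at goal'
  exact goal'

end
end

section
/- The three-step stepsize pattern h = (3/2, 49/10, 3/2) is straightforward (i.e., 0-straightforward for some parameter Δ ∈ (0,1/2]; in fact Δ = 10⁻⁴ suffices). Consequently, for every convex L-smooth f : ℝ^n → ℝ with a minimizer x_⋆, every x_0 with D := sup{‖x − x_⋆‖₂ : f(x) ≤ f(x_0)} finite, and gradient descent with pattern h from x_0 (cycling through stepsizes (3/2)/L, (49/10)/L, (3/2)/L), there exists a constant C ≥ 0 such that for every T > 0 divisible by 3, f(x_T) − f(x_⋆) ≤ L·D² / ((79/30)·T) + C/T². -/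
open scoped BigOperators

noncomputable section

/-- The squared norm of a combination of five vectors is nonnegative (expanded form). -/
theorem gram_sq {V : Type*} [NormedAddCommGroup V] [InnerProductSpace ℝ V]
    (x a b c d : V) (r0 r1 r2 r3 r4 : ℝ) :
    0 ≤ r0 ^ 2 * inner ℝ x x + r1 ^ 2 * inner ℝ a a + r2 ^ 2 * inner ℝ b b
      + r3 ^ 2 * inner ℝ c c + r4 ^ 2 * inner ℝ d d
      + 2 * (r0 * r1 * inner ℝ x a + r0 * r2 * inner ℝ x b + r0 * r3 * inner ℝ x c
        + r0 * r4 * inner ℝ x d + r1 * r2 * inner ℝ a b + r1 * r3 * inner ℝ a c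
        + r1 * r4 * inner ℝ a d + r2 * r3 * inner ℝ b c + r2 * r4 * inner ℝ b d
        + r3 * r4 * inner ℝ c d) := by
  have h : 0 ≤ inner ℝ (r0 • x + r1 • a + r2 • b + r3 • c + r4 • d)
      (r0 • x + r1 • a + r2 • b + r3 • c + r4 • d) := real_inner_self_nonneg
  simp only [inner_add_left, inner_add_right, real_inner_smul_left, real_inner_smul_right] at h
  rw [real_inner_comm x a, real_inner_comm x b, real_inner_comm x c, real_inner_comm x d,
    real_inner_comm a b, real_inner_comm a c, real_inner_comm a d,
    real_inner_comm b c, real_inner_comm b d, real_inner_comm c d] at h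
  linarith

/-- The three-step estimate in normalized units (`L = D = 1`, minimizer at the origin with
minimal value zero), from finitely many interpolation inequalities. -/
theorem three_step_core {V : Type*} [NormedAddCommGroup V] [InnerProductSpace ℝ V]
    (x0 x1 x2 x3 a b c d : V) (f0 f1 f2 f3 δ : ℝ) (hδ0 : 0 ≤ δ) (hδ : δ ≤ 1 / 10000)
    (hx : inner ℝ x0 x0 ≤ (1 : ℝ)) (hf : f0 ≤ δ)
    (h1 : x1 = x0 - (3 / 2 : ℝ) • a) (h2 : x2 = x1 - (49 / 10 : ℝ) • b)
    (h3 : x3 = x2 - (3 / 2 : ℝ) • c)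
    (q0 : f0 - inner ℝ a x0 + 1 / 2 * inner ℝ a a ≤ 0)
    (q1 : f1 - inner ℝ b x1 + 1 / 2 * inner ℝ b b ≤ 0)
    (q2 : f2 - inner ℝ c x2 + 1 / 2 * inner ℝ c c ≤ 0)
    (q3 : f3 - inner ℝ d x3 + 1 / 2 * inner ℝ d d ≤ 0)
    (q01 : f1 + inner ℝ b (x0 - x1) + 1 / 2 * inner ℝ (a - b) (a - b) ≤ f0)
    (q10 : f0 + inner ℝ a (x1 - x0) + 1 / 2 * inner ℝ (b - a) (b - a) ≤ f1)
    (q12 : f2 + inner ℝ c (x1 - x2) + 1 / 2 * inner ℝ (b - c) (b - c) ≤ f1)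
    (q13 : f3 + inner ℝ d (x1 - x3) + 1 / 2 * inner ℝ (b - d) (b - d) ≤ f1)
    (q23 : f3 + inner ℝ d (x2 - x3) + 1 / 2 * inner ℝ (c - d) (c - d) ≤ f2) :
    f3 ≤ δ - 79 / 10 * δ ^ 2 := by
  subst h1 h2 h3
  simp only [inner_sub_left, inner_sub_right, real_inner_smul_right] at *
  simp only [real_inner_comm x0 a, real_inner_comm x0 b, real_inner_comm x0 c,
    real_inner_comm x0 d, real_inner_comm a b, real_inner_comm a c, real_inner_comm a d,
    real_inner_comm b c, real_inner_comm b d, real_inner_comm c d] at *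
  have h00 := gram_sq x0 a b c d (-3/2 * δ) (1) (1/2) (0) (0)
  have h01 := gram_sq x0 a b c d (-1571/791 * δ) (0) (1) (1989/3955) (273/565)
  have h02 := gram_sq x0 a b c d (-64150/25993 * δ) (0) (0) (1) (38157/25993)
  have h03 := gram_sq x0 a b c d (-1 * δ) (0) (0) (0) (1)
  have h10 := gram_sq x0 a b c d (-5000/3071 * δ) (1) (1732/3071) (3999/122840) (47/1480)
  have h11 := gram_sq x0 a b c d (-6029202500/3034577219 * δ) (0) (1)
    (610373596401/1213830887600) (587353770599/1213830887600)
  have h12 := gram_sq x0 a b c d (-5961130345599000000/2399470917998434019 * δ) (0) (0) (1)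
    (3475373897267477981/2399470917998434019)
  have h13 := gram_sq x0 a b c d (-5554098242259668244000/6342975752849234611883 * δ)
    (0) (0) (0) (1)
  have h14 := gram_sq x0 a b c d (1 * δ) (0) (0) (0) (0)
  generalize inner ℝ x0 x0 = pxx at *
  generalize inner ℝ x0 a = pxa at *
  generalize inner ℝ x0 b = pxb at *
  generalize inner ℝ x0 c = pxc at *
  generalize inner ℝ x0 d = pxd at *
  generalize inner ℝ a a = paa at *
  generalize inner ℝ a b = pab at *
  generalize inner ℝ a c = pac at *
  generalize inner ℝ a d = pad at *
  generalize inner ℝ b b = pbb at *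
  generalize inner ℝ b c = pbc at *
  generalize inner ℝ b d = pbd at *
  generalize inner ℝ c c = pcc at *
  generalize inner ℝ c d = pcd at *
  generalize inner ℝ d d = pdd at *
  have S0 : 0 ≤ 79/10 * δ^2 * pxx
      - 2 * δ * (3/200 * pxa + 787/200 * pxb + 3999/2000 * pxc + 3901/2000 * pxd)
      + (1/100 * paa + 99/50 * pbb + 51/100 * pcc + 1/2 * pdd
        + 2 * (1/200 * pab + 1989/2000 * pbc + 1911/2000 * pbd + 99/200 * pcd)) := by
    linear_combination 1/100 * h00 + 791/400 * h01 + 77979/7910000 * h02 + 1775/103972 * h03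
  have S1 : 0 ≤ 79/10 * δ^2 * pxx
      - 2 * δ * (3/200 * pxa + 787/200 * pxb + 3999/2000 * pxc + 3901/2000 * pxd)
      + (1/100 * paa + 99/50 * pbb + 51/100 * pcc + 1/2 * pdd
        + 2 * (1/200 * pab + 1989/2000 * pbc + 1911/2000 * pbd + 99/200 * pcd))
      + 1/10000 * (-787/100 * paa - 79/10 * pbb - 3901/1000 * pcc
        + 2 * (49/25 * pab + 11997/4000 * pac + 11703/4000 * pad - 112149/20000 * pbc
          + 191149/20000 * pbd + 3901/2000 * pcd)) := by
    linear_combination 9213/1000000 * h10 + 3034577219/1535500000 * h11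
      + 2399470917998434019/242766177520000000000 * h12
      + 6342975752849234611883/383915346879749443040000 * h13
      + 33087476762678088757/63429757528492346118830 * h14
  clear h00 h01 h02 h03 h10 h11 h12 h13 h14
  have T0 := mul_nonneg (by linarith : (0:ℝ) ≤ 1 - 10000 * δ) S0
  have T1 := mul_nonneg (by linarith : (0:ℝ) ≤ 10000 * δ) S1
  have V := mul_nonneg (by positivity : (0:ℝ) ≤ 79/10 * δ^2) (sub_nonneg.2 hx)
  have W := mul_nonneg (by linarith : (0:ℝ) ≤ 1 - 79/5 * δ) (sub_nonneg.2 hf)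
  have R0 := mul_nonneg (by linarith : (0:ℝ) ≤ 2 * (3/200) * δ) (sub_nonneg.2 q0)
  have R1 := mul_nonneg (by linarith : (0:ℝ) ≤ 2 * (787/200) * δ) (sub_nonneg.2 q1)
  have R2 := mul_nonneg (by linarith : (0:ℝ) ≤ 2 * (3999/2000) * δ) (sub_nonneg.2 q2)
  have R3 := mul_nonneg (by linarith : (0:ℝ) ≤ 2 * (3901/2000) * δ) (sub_nonneg.2 q3)
  have R01 := mul_nonneg (by linarith : (0:ℝ) ≤ 99/50 - 1577/100 * δ) (sub_nonneg.2 q01)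
  have R12 := mul_nonneg (by linarith : (0:ℝ) ≤ 51/100 - 79/10 * δ) (sub_nonneg.2 q12)
  have R23 := mul_nonneg (by linarith : (0:ℝ) ≤ 51/100 - 3901/1000 * δ) (sub_nonneg.2 q23)
  linear_combination T0 + T1 + V + W + R0 + R1 + R2 + R3 + R01 + R12 + R23
    + 49/50 * q10 + 49/100 * q13

/-- First-order convexity inequality. -/
theorem grad_ineq {n : ℕ} {f : E n → ℝ} (hc : ConvexOn ℝ Set.univ f)
    (hd : Differentiable ℝ f) (x y : E n) :
    f x + inner ℝ (gradient f x) (y - x) ≤ f y := by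
  have hline : ∀ t : ℝ, HasDerivAt (fun t : ℝ => f (x + t • (y - x)))
      (inner ℝ (gradient f (x + t • (y - x))) (y - x)) t := by
    intro t
    have h1 : HasDerivAt (fun t : ℝ => x + t • (y - x)) (y - x) t := by
      simpa using ((hasDerivAt_id t).smul_const (y - x)).const_add x
    exact ((hd (x + t • (y - x))).hasGradientAt).hasFDerivAt.comp_hasDerivAt t h1
  have hconv : ConvexOn ℝ Set.univ (fun t : ℝ => f (x + t • (y - x))) := by
    refine ⟨convex_univ, ?_⟩
    intro s _ t _ a b ha hb hab
    have h := hc.2 (Set.mem_univ (x + s • (y - x))) (Set.mem_univ (x + t • (y - x))) ha hb hab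
    have e : a • (x + s • (y - x)) + b • (x + t • (y - x))
        = x + (a • s + b • t) • (y - x) := by
      have : a • x + b • x = x := by rw [← add_smul, hab, one_smul]
      calc _ = (a • x + b • x) + (a • s + b • t) • (y - x) := by
            simp only [smul_add, add_smul, smul_smul, smul_eq_mul]; abel
        _ = _ := by rw [this]
    rw [e] at h
    exact h
  have h := hconv.le_slope_of_hasDerivAt (Set.mem_univ (0:ℝ)) (Set.mem_univ (1:ℝ)) one_pos
    (hline 0)
  simp only [slope_def_field, zero_smul, one_smul, add_zero, add_sub_cancel, sub_zero,
    div_one] at h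
  linarith

/-- The descent lemma. -/
theorem descent_ineq {n : ℕ} {L : ℝ} {f : E n → ℝ} (hs : IsLSmooth L f) (x y : E n) :
    f y ≤ f x + inner ℝ (gradient f x) (y - x) + L / 2 * ‖y - x‖ ^ 2 := by
  obtain ⟨hd, hl⟩ := hs
  have hline : ∀ t : ℝ, HasDerivAt (fun t : ℝ => f (x + t • (y - x))
        - t * inner ℝ (gradient f x) (y - x) - t ^ 2 * (L / 2 * ‖y - x‖ ^ 2))
      (inner ℝ (gradient f (x + t • (y - x))) (y - x) - inner ℝ (gradient f x) (y - x)
        - 2 * t * (L / 2 * ‖y - x‖ ^ 2)) t := by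
    intro t
    have h1 : HasDerivAt (fun t : ℝ => x + t • (y - x)) (y - x) t := by
      simpa using ((hasDerivAt_id t).smul_const (y - x)).const_add x
    have h2 := ((hd (x + t • (y - x))).hasGradientAt).hasFDerivAt.comp_hasDerivAt t h1
    have h3 : HasDerivAt (fun t : ℝ => f (x + t • (y - x)))
      (inner ℝ (gradient f (x + t • (y - x))) (y - x)) t := h2
    have h4 := (hasDerivAt_id t).mul_const (inner ℝ (gradient f x) (y - x))
    have h5 := (hasDerivAt_pow 2 t).mul_const (L / 2 * ‖y - x‖ ^ 2)
    have h6 := (h3.sub h4).sub h5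
    convert h6 using 1 <;> first | rfl | (norm_num)
  have hanti := antitoneOn_of_deriv_nonpos (convex_Icc (0:ℝ) 1)
    (f := fun t : ℝ => f (x + t • (y - x))
        - t * inner ℝ (gradient f x) (y - x) - t ^ 2 * (L / 2 * ‖y - x‖ ^ 2))
    (fun t _ => (hline t).continuousAt.continuousWithinAt)
    (fun t _ => (hline t).differentiableAt.differentiableWithinAt)
    (by
      intro t ht
      rw [interior_Icc] at ht
      rw [(hline t).deriv, ← inner_sub_left]
      have h1 := real_inner_le_norm (gradient f (x + t • (y - x)) - gradient f x) (y - x)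
      have h2 := hl (x + t • (y - x)) x
      have h3 : ‖x + t • (y - x) - x‖ = t * ‖y - x‖ := by
        rw [add_sub_cancel_left, norm_smul, Real.norm_of_nonneg ht.1.le]
      rw [h3] at h2
      have h4 := mul_le_mul_of_nonneg_right h2 (norm_nonneg (y - x))
      nlinarith)
  have h := hanti (Set.left_mem_Icc.2 zero_le_one) (Set.right_mem_Icc.2 zero_le_one) zero_le_one
  simp only [zero_smul, one_smul, add_zero, add_sub_cancel, zero_mul, one_mul, sub_zero,
    one_pow, ne_eq, OfNat.ofNat_ne_zero, not_false_eq_true, zero_pow] at h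
  linarith

/-- The interpolation inequality of smooth convex functions. -/
theorem interp_ineq {n : ℕ} {L : ℝ} (hL : 0 < L) {f : E n → ℝ}
    (hc : ConvexOn ℝ Set.univ f) (hs : IsLSmooth L f) (x y : E n) :
    f x + inner ℝ (gradient f x) (y - x)
      + 1 / (2 * L) * inner ℝ (gradient f y - gradient f x) (gradient f y - gradient f x)
      ≤ f y := by
  set d := gradient f y - gradient f x with hd
  have h1 := grad_ineq hc hs.1 x (y - (1 / L) • d)
  have h2 := descent_ineq hs y (y - (1 / L) • d)
  have e1 : y - (1 / L) • d - x = (y - x) - (1 / L) • d := by abel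
  have e2 : y - (1 / L) • d - y = - ((1 / L) • d) := by abel
  have e3 : gradient f y = d + gradient f x := by rw [hd]; abel
  have e4 : ‖-((1 / L) • d)‖ ^ 2 = (1 / L) * ((1 / L) * inner ℝ d d) := by
    rw [norm_neg, ← real_inner_self_eq_norm_sq, real_inner_smul_left, real_inner_smul_right]
  rw [e1, inner_sub_right, real_inner_smul_right] at h1
  rw [e2, e4, e3, inner_neg_right, real_inner_smul_right, inner_add_left] at h2
  have e5 : L / 2 * (1 / L * (1 / L * inner ℝ d d)) = 1 / (2 * L) * inner ℝ d d := by
    field_simp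
  have e6 : 1 / L * inner ℝ d d = 2 * (1 / (2 * L) * inner ℝ d d) := by
    field_simp
  rw [e5, mul_add, e6] at h2
  linarith

/-- The gradient vanishes at a minimizer. -/
theorem grad_eq_zero {n : ℕ} {f : E n → ℝ} (x : E n) (hx : ∀ z, f x ≤ f z) :
    gradient f x = 0 := by
  have h : IsLocalMin f x := Filter.Eventually.of_forall hx
  rw [gradient, h.fderiv_eq_zero, map_zero]

/-- The interpolation inequality in normalized units. -/
theorem interp_norm {n : ℕ} {L D : ℝ} (hL : 0 < L) (hD : 0 < D) {f : E n → ℝ}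
    (hc : ConvexOn ℝ Set.univ f) (hs : IsLSmooth L f) (s x y : E n) :
    (f x - f s) / (L * D ^ 2)
      + inner ℝ ((1 / (L * D)) • gradient f x) ((1 / D) • (y - s) - (1 / D) • (x - s))
      + 1 / 2 * inner ℝ ((1 / (L * D)) • gradient f y - (1 / (L * D)) • gradient f x)
          ((1 / (L * D)) • gradient f y - (1 / (L * D)) • gradient f x)
      ≤ (f y - f s) / (L * D ^ 2) := by
  have h := interp_ineq hL hc hs x y
  rw [← smul_sub, ← smul_sub, sub_sub_sub_cancel_right]
  simp only [real_inner_smul_left, real_inner_smul_right]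
  generalize inner ℝ (gradient f x) (y - x) = p at *
  generalize inner ℝ (gradient f y - gradient f x) (gradient f y - gradient f x) = q at *
  have hp : 0 < L * D ^ 2 := by positivity
  rw [le_div_iff₀ hp]
  have e : ((f x - f s) / (L * D ^ 2) + 1 / D * (1 / (L * D) * p)
      + 1 / 2 * (1 / (L * D) * (1 / (L * D) * q))) * (L * D ^ 2)
      = f x - f s + p + 1 / (2 * L) * q := by
    field_simp
  rw [e]
  linarith

theorem straightforward_three (h : ℕ → ℝ)
    (hdef : h = fun k => if k % 3 = 1 then 49 / 10 else 3 / 2) :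
    IsStraightforward 3 h 0 (1e-4) := by
  intro n L D δ hL hD hδ0 hδ g hc hs ys hmin y hy0 hg0 hy
  have hp : 0 < L * D ^ 2 := by positivity
  have hgs := grad_eq_zero ys hmin
  have key : ∀ x z : E n, _ := interp_norm hL hD hc hs ys
  have star : ∀ z : E n, (g z - g ys) / (L * D ^ 2)
      - inner ℝ ((1 / (L * D)) • gradient g z) ((1 / D) • (z - ys))
      + 1 / 2 * inner ℝ ((1 / (L * D)) • gradient g z) ((1 / (L * D)) • gradient g z) ≤ 0 := by
    intro z
    have := key z ys
    rw [hgs] at this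
    simp only [sub_self, smul_zero, zero_sub, zero_div, inner_neg_right, inner_neg_left] at this
    linarith
  have step : ∀ k < 3, (1 / D) • (y (k + 1) - ys)
      = (1 / D) • (y k - ys) - h k • ((1 / (L * D)) • gradient g (y k)) := by
    intro k hk
    rw [hy k hk, sub_right_comm, smul_sub, smul_smul, smul_smul]
    congr 2
    field_simp
  have hh0 : h 0 = 3 / 2 := by simp [hdef]
  have hh1 : h 1 = 49 / 10 := by simp [hdef]
  have hh2 : h 2 = 3 / 2 := by simp [hdef]
  have s0 := step 0 (by norm_num)
  have s1 := step 1 (by norm_num)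
  have s2 := step 2 (by norm_num)
  rw [hh0] at s0
  rw [hh1] at s1
  rw [hh2] at s2
  have hx : inner ℝ ((1 / D) • (y 0 - ys)) ((1 / D) • (y 0 - ys)) ≤ (1 : ℝ) := by
    rw [real_inner_self_eq_norm_sq, norm_smul, Real.norm_of_nonneg (by positivity)]
    have h1 : 1 / D * ‖y 0 - ys‖ ≤ 1 := by
      rw [one_div, inv_mul_le_iff₀ hD]; simpa using hy0
    exact pow_le_one₀ (by positivity) h1
  have main := three_step_core _ _ _ _ _ _ _ _ _ _ _ _ (δ / (L * D ^ 2))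
    (by positivity) (by rw [div_le_iff₀ hp]; norm_num at hδ ⊢; linarith) hx
    (div_le_div_of_nonneg_right hg0 hp.le) s0 s1 s2
    (star (y 0)) (star (y 1)) (star (y 2)) (star (y 3))
    (key (y 1) (y 0)) (key (y 0) (y 1)) (key (y 2) (y 1)) (key (y 3) (y 1)) (key (y 3) (y 2))
  rw [div_le_iff₀ hp] at main
  have e : (δ / (L * D ^ 2) - 79 / 10 * (δ / (L * D ^ 2)) ^ 2) * (L * D ^ 2)
      = δ - ((∑ i ∈ Finset.range 3, (h i - 0)) / (L * D ^ 2)) * δ ^ 2 := by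
    simp only [Finset.sum_range_succ, Finset.sum_range_zero, hh0, hh1, hh2]
    field_simp
    ring
  rw [← e]
  exact main

/-- Rate of a scalar sequence with linear decrease above a threshold and sublinear decrease
below it. -/
theorem seq_rate (u : ℕ → ℝ) (M : ℝ) (hM : 0 < M) (hu : ∀ k, 0 ≤ u k) (hmono : ∀ k, u k ≤ u 0)
    (hA : ∀ k, u k ≤ M / 10000 → u (k + 1) ≤ u k - 79 / 10 / M * u k ^ 2)
    (hB : ∀ k, M / 10000 < u k → u (k + 1) ≤ (1 - 79 / 100000) * u k) :
    ∃ C : ℝ, 0 ≤ C ∧ ∀ k : ℕ, 0 < k → u k ≤ M / (79 / 10 * k) + C / (k : ℝ) ^ 2 := by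
  have hex : ∃ k0, u k0 ≤ M / 10000 := by
    by_contra! hcon
    have hpow : ∀ k, u k ≤ (1 - 79 / 100000 : ℝ) ^ k * u 0 := by
      intro k
      induction k with
      | zero => simp
      | succ k ih =>
        have := hB k (hcon k)
        rw [pow_succ]
        nlinarith
    have hu0 : 0 < u 0 := lt_trans (by positivity) (hcon 0)
    obtain ⟨k, hk⟩ := exists_pow_lt_of_lt_one (show 0 < M / 10000 / u 0 by positivity)
      (show (1 - 79 / 100000 : ℝ) < 1 by norm_num)
    rw [lt_div_iff₀ hu0] at hk
    linarith [hpow k, hcon k]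
  obtain ⟨k0, hk0⟩ := hex
  have hj : ∀ j : ℕ, u (k0 + j) ≤ M / (79 / 10 * j + 10000) := by
    intro j
    induction j with
    | zero => simpa using hk0
    | succ j ih =>
      have hjn : (0:ℝ) ≤ j := Nat.cast_nonneg j
      have hpos : (0:ℝ) < 79 / 10 * j + 10000 := by positivity
      have h1 : u (k0 + j) ≤ M / 10000 :=
        ih.trans (div_le_div_of_nonneg_left hM.le (by norm_num) (by linarith))
      have h2 := hA _ h1
      have e : k0 + (j + 1) = k0 + j + 1 := by ring
      rw [e]
      refine h2.trans ?_
      obtain ⟨w, hw⟩ : ∃ w, w = u (k0 + j) / M := ⟨_, rfl⟩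
      have hw1 : u (k0 + j) = M * w := by rw [hw]; field_simp
      have hw0 : 0 ≤ w := by rw [hw]; exact div_nonneg (hu _) hM.le
      rw [hw1, le_div_iff₀ hpos] at ih
      rw [hw1] at h1
      have hwa : w * (79 / 10 * j + 10000) ≤ 1 := by
        by_contra! hcon
        have := mul_lt_mul_of_pos_left hcon hM
        linarith
      have hws : w ≤ 1 / 10000 := by
        by_contra! hcon
        have := mul_lt_mul_of_pos_left hcon hM
        linarith
      push_cast
      rw [hw1, le_div_iff₀ (by linarith)]
      have e2 : (M * w - 79 / 10 / M * (M * w) ^ 2) * (79 / 10 * (j + 1) + 10000)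
          = M * ((1 - 79 / 10 * w) * (w * (79 / 10 * j + 10000) + 79 / 10 * w)) := by
        field_simp
        ring
      rw [e2]
      have h3 : (1 - 79 / 10 * w) * (w * (79 / 10 * j + 10000) + 79 / 10 * w)
          ≤ (1 - 79 / 10 * w) * (1 + 79 / 10 * w) :=
        mul_le_mul_of_nonneg_left (by linarith) (by linarith)
      have h4 : (1 - 79 / 10 * w) * (1 + 79 / 10 * w) ≤ 1 := by nlinarith
      have h5 := mul_le_mul_of_nonneg_left (h3.trans h4) hM.le
      linarith
  have hC1 : 0 ≤ M * k0 * (k0 + 1) := by positivity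
  have hC2 : 0 ≤ u 0 * (k0 : ℝ) ^ 2 := mul_nonneg (hu 0) (by positivity)
  refine ⟨M * k0 * (k0 + 1) + u 0 * (k0 : ℝ) ^ 2, by positivity, ?_⟩
  intro k hk
  have hkR : (0:ℝ) < k := by exact_mod_cast hk
  rcases lt_or_ge k k0 with hlt | hge
  · have hltR : (k:ℝ) ≤ k0 := by exact_mod_cast hlt.le
    have h1 : u 0 ≤ (M * k0 * (k0 + 1) + u 0 * (k0 : ℝ) ^ 2) / (k : ℝ) ^ 2 := by
      rw [le_div_iff₀ (by positivity)]
      have := mul_le_mul_of_nonneg_left (pow_le_pow_left₀ hkR.le hltR 2) (hu 0)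
      linarith
    have h2 : 0 ≤ M / (79 / 10 * (k:ℝ)) := by positivity
    linarith [hmono k]
  · obtain ⟨j, rfl⟩ := Nat.exists_eq_add_of_le hge
    have h1 := hj j
    have hjn : (0:ℝ) ≤ j := Nat.cast_nonneg j
    have hk0n : (0:ℝ) ≤ k0 := Nat.cast_nonneg k0
    have h2 : M / (79 / 10 * j + 10000) ≤ M / (79 / 10 * ((k0 + j : ℕ) : ℝ))
        + M * k0 * (k0 + 1) / ((k0 + j : ℕ) : ℝ) ^ 2 := by
      set K : ℝ := ((k0 + j : ℕ) : ℝ) with hK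
      have hKe : K = k0 + j := by rw [hK]; push_cast; ring
      have hpos : (0:ℝ) < 79 / 10 * j + 10000 := by positivity
      have e : M / (79 / 10 * K) + M * k0 * (k0 + 1) / K ^ 2
          = M * (K + 79 / 10 * (k0 * (k0 + 1))) / (79 / 10 * K ^ 2) := by
        field_simp
      rw [e, div_le_div_iff₀ hpos (by positivity), mul_assoc]
      refine mul_le_mul_of_nonneg_left ?_ hM.le
      have a1 : K * (79 / 10 * K) ≤ K * (79 / 10 * j + 10000) + K * (79 / 10 * k0) := by
        rw [hKe]; nlinarith
      have a2 : K ≤ (k0 + 1) * (79 / 10 * j + 10000) := by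
        rw [hKe]; nlinarith [mul_nonneg hk0n hjn]
      have a3 := mul_le_mul_of_nonneg_left a2 (by positivity : (0:ℝ) ≤ 79 / 10 * k0)
      linarith
    have h3 : M * k0 * (k0 + 1) / ((k0 + j : ℕ) : ℝ) ^ 2
        ≤ (M * k0 * (k0 + 1) + u 0 * (k0 : ℝ) ^ 2) / ((k0 + j : ℕ) : ℝ) ^ 2 :=
      div_le_div_of_nonneg_right (by linarith) (by positivity)
    linarith

/-- Theorem 3.5: the three-step pattern `h = (3/2, 49/10, 3/2)` is straightforward
(0-straightforward with parameter `Δ = 10⁻⁴`); consequently gradient descent cycling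
through these stepsizes over `L` satisfies
`f (x T) - f x⋆ ≤ L D² / ((79/30) T) + C/T²` for all `T > 0` divisible by `3`. -/
theorem three_step_pattern_rate
    (h : ℕ → ℝ) (hdef : h = fun k => if k % 3 = 1 then 49 / 10 else 3 / 2) :
    IsStraightforward 3 h 0 (1e-4)
    ∧ (∀ (n : ℕ) (L : ℝ), 0 < L →
        ∀ f : E n → ℝ, ConvexOn ℝ Set.univ f → IsLSmooth L f →
          ∀ xstar : E n, (∀ z, f xstar ≤ f z) →
            ∀ (x : ℕ → E n) (x0 : E n), x 0 = x0 →
              ∀ D : ℝ, IsLUB {r : ℝ | ∃ z : E n, f z ≤ f x0 ∧ r = ‖z - xstar‖} D →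
                (∀ k : ℕ, x (k + 1) = x k - (h (k % 3) / L) • gradient f (x k)) →
                ∃ C : ℝ, 0 ≤ C ∧ ∀ T : ℕ, 0 < T → 3 ∣ T →
                  f (x T) - f xstar ≤
                    L * D ^ 2 / ((79 / 30) * T) + C / (T : ℝ) ^ 2) := by
  have hS := straightforward_three h hdef
  refine ⟨hS, ?_⟩
  intro n L hL f hc hs xs hmin x x0 hx0 D hD hx
  have hh : ∀ k, h (k % 3) = h k := by intro k; simp [hdef]
  have hper : ∀ k i, h (3 * k + i) = h i := by
    intro k i; simp [hdef, Nat.add_mod]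
  have hsum : ∑ i ∈ Finset.range 3, (h i - 0) = 79 / 10 := by
    simp only [Finset.sum_range_succ, Finset.sum_range_zero]
    simp only [hdef]
    norm_num
  have hball : ∀ z, f z ≤ f x0 → ‖z - xs‖ ≤ D := fun z hz => hD.1 ⟨z, hz, rfl⟩
  have hu : ∀ k, 0 ≤ f (x (3 * k)) - f xs := fun k => sub_nonneg.2 (hmin _)
  have pass : ∀ (k : ℕ) (D' : ℝ), 0 < D' → ‖x (3 * k) - xs‖ ≤ D' →
      f (x (3 * k)) - f xs ≤ L * D' ^ 2 * 1e-4 →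
      f (x (3 * (k + 1))) - f xs ≤ (f (x (3 * k)) - f xs)
        - 79 / 10 / (L * D' ^ 2) * (f (x (3 * k)) - f xs) ^ 2 := by
    intro k D' hD' hk hle
    have := hS n L D' (f (x (3 * k)) - f xs) hL hD' (hu k) hle f hc hs xs hmin
      (fun i => x (3 * k + i)) (by simpa using hk) le_rfl
      (by
        intro i _
        have := hx (3 * k + i)
        rw [hh, hper] at this
        exact this)
    rw [hsum] at this
    exact this
  have hD0 : 0 ≤ D := (norm_nonneg _).trans (hball x0 le_rfl)
  rcases hD0.eq_or_lt with hDz | hDpos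
  · refine ⟨0, le_rfl, ?_⟩
    have hx0s : x0 = xs := by
      have := hball x0 le_rfl
      rw [← hDz] at this
      exact sub_eq_zero.1 (norm_le_zero_iff.1 this)
    have hall : ∀ k, x k = xs := by
      intro k
      induction k with
      | zero => rw [hx0, hx0s]
      | succ k ih => rw [hx k, ih, grad_eq_zero xs hmin]; simp
    intro T _ _
    rw [hall T, ← hDz]
    simp
  have hM : 0 < L * D ^ 2 := by positivity
  have hA : ∀ k, f (x (3 * k)) ≤ f x0 → f (x (3 * k)) - f xs ≤ L * D ^ 2 / 10000 →
      f (x (3 * (k + 1))) - f xs ≤ (f (x (3 * k)) - f xs)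
        - 79 / 10 / (L * D ^ 2) * (f (x (3 * k)) - f xs) ^ 2 := by
    intro k hk hle
    refine pass k D hDpos (hball _ hk) ?_
    norm_num
    linarith
  have hB : ∀ k, f (x (3 * k)) ≤ f x0 → L * D ^ 2 / 10000 < f (x (3 * k)) - f xs →
      f (x (3 * (k + 1))) - f xs ≤ (1 - 79 / 100000) * (f (x (3 * k)) - f xs) := by
    intro k hk hlt
    set v := f (x (3 * k)) - f xs with hv
    have hvpos : 0 < v := lt_trans (by positivity) hlt
    have hq : 0 ≤ 10000 * v / L := by positivity
    have hDle : D ≤ √(10000 * v / L) := by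
      refine Real.le_sqrt_of_sq_le ?_
      rw [le_div_iff₀ hL]
      linarith
    have e : L * √(10000 * v / L) ^ 2 = 10000 * v := by
      rw [Real.sq_sqrt hq]; field_simp
    have := pass k (√(10000 * v / L)) (by positivity) ((hball _ hk).trans hDle)
      (by rw [e]; norm_num; linarith)
    rw [e, ← hv] at this
    have e2 : 79 / 10 / (10000 * v) * v ^ 2 = 79 / 100000 * v := by
      field_simp; norm_num
    rw [e2] at this
    linarith
  have hmono : ∀ k, f (x (3 * k)) ≤ f x0 := by
    intro k
    induction k with
    | zero => simp [hx0]
    | succ k ih =>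
      have h0 := hu k
      rcases le_or_gt (f (x (3 * k)) - f xs) (L * D ^ 2 / 10000) with hle | hlt
      · have h1 := hA k ih hle
        have h2 : 0 ≤ 79 / 10 / (L * D ^ 2) * (f (x (3 * k)) - f xs) ^ 2 := by positivity
        linarith
      · have h1 := hB k ih hlt
        linarith
  obtain ⟨C, hC, hrate⟩ := seq_rate (fun k => f (x (3 * k)) - f xs) (L * D ^ 2) hM hu
    (by intro k; have := hmono k; simp only [mul_zero, hx0]; linarith)
    (fun k => hA k (hmono k)) (fun k => hB k (hmono k))
  refine ⟨9 * C, by positivity, ?_⟩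
  rintro T hT ⟨k, rfl⟩
  have hk : 0 < k := by omega
  have hkR : (0:ℝ) < k := by exact_mod_cast hk
  have := hrate k hk
  have e : L * D ^ 2 / ((79 / 30) * ((3 * k : ℕ) : ℝ)) + 9 * C / ((3 * k : ℕ) : ℝ) ^ 2
      = L * D ^ 2 / (79 / 10 * k) + C / (k : ℝ) ^ 2 := by
    push_cast
    congr 1
    · congr 1; ring
    · field_simp; ring
  rw [e]
  exact this

end
end

section
/- The fifteen-step stepsize pattern h = (7/5, 2, 7/5, 9/2, 7/5, 2, 7/5, 297/10, 7/5, 2, 7/5, 9/2, 7/5, 2, 7/5) is 10⁻⁹-straightforward with parameter Δ = 10⁻⁶. Consequently, for every convex L-smooth f : ℝ^n → ℝ with a minimizer x_⋆, every x_0 with D := sup{‖x − x_⋆‖₂ : f(x) ≤ f(x_0)} finite, and gradient descent with pattern h from x_0, there exists a constant C ≥ 0 such that for every T > 0 divisible by 15, f(x_T) − f(x_⋆) ≤ L·D² / ((193/50 − 10⁻⁹)·T) + C/T². -/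
open scoped BigOperators

noncomputable section

/-- Ten times the stepsizes (padded by a zero). -/
def tabH : List ℤ :=
  [14, 20, 14, 45, 14, 20, 14, 297, 14, 20, 14, 45, 14, 20, 14, 0]

/-- Dual multipliers, scaled by `10^6`. -/
def tabA : List (List ℤ) :=
  [[0, 1606264, 47815, 45264, 0, 0, 0, 0, 0, 0, 0, 0, 0, 0, 0, 0],
   [545956, 0, 2088575, 284503, 0, 0, 0, 0, 0, 0, 0, 0, 0, 0, 0, 0],
   [75636, 158556, 0, 5995866, 0, 0, 11, 11, 0, 0, 0, 0, 0, 0, 0, 0],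
   [77494, 1153813, 4093198, 0, 605386, 864465, 604633, 436440, 0, 0, 195, 261, 35, 39, 38, 39],
   [0, 0, 0, 0, 0, 2071617, 0, 0, 1296, 1914, 32, 31, 0, 0, 0, 0],
   [14, 14, 14, 15, 868195, 0, 2870717, 2111556, 0, 0, 2933, 1495, 21, 24, 24, 24],
   [120, 192, 230, 2609, 0, 0, 0, 11946398, 0, 0, 0, 0, 24, 31, 29, 30],
   [109, 176, 228, 1507744, 600801, 2916908, 8473912, 0, 47235, 68030, 45115, 232727, 82723, 153286, 161775, 204138],
   [0, 0, 0, 0, 0, 0, 0, 0, 0, 82993, 0, 0, 0, 0, 0, 0],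
   [0, 0, 0, 0, 0, 0, 0, 0, 34295, 0, 115038, 85288, 0, 0, 0, 0],
   [0, 0, 0, 0, 0, 0, 0, 0, 0, 0, 0, 479836, 0, 0, 0, 0],
   [14, 19, 20, 35, 508, 2056, 390, 502, 64, 80497, 316523, 0, 54489, 101242, 107396, 135883],
   [0, 0, 0, 0, 0, 0, 0, 0, 24, 879, 0, 0, 0, 138565, 12105, 10405],
   [0, 0, 0, 0, 0, 0, 0, 0, 21, 81, 0, 0, 6264, 0, 220442, 202911],
   [0, 0, 0, 0, 0, 0, 0, 0, 27, 117, 0, 0, 10019, 11021, 0, 634649],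
   [0, 0, 0, 0, 0, 0, 0, 0, 31, 110, 0, 0, 8403, 25511, 154024, 0]]

/-- Matrix of the quadratic form of the multipliers, scaled by `2 * 10^7`. -/
def tabT : List (List ℤ) :=
  [[4405256, -38260760, -3133328, -928410, -7196, -9720, -3444, -8316, -392, -560, -392, 0, 0, 0, 0, 0],
   [34056272, 5869880, -74089492, -5726150, -11228, -15480, -5460, -11286, -532, -760, -532, 0, 0, 0, 0, 0],
   [-173900, 82284480, 9978280, -119961600, -13776, -19120, -7164, -12100, -560, -800, -560, 0, 0, 0, 0, 0],
   [-282488, -9885580, 95253764, 20784450, -54399004, -77704820, -54310472, -8749590, -980, -1400, -4880, -5220, -700, -780, -760, -780],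
   [0, 0, 0, 54484740, 351688, -65484700, -16836652, -301752, -40144, -58600, -14864, -620, 0, 0, 0, 0],
   [-280, -280, -280, 77801550, 64846396, 342360, -139145332, -43452384, -57568, -82240, -116228, -29900, -420, -480, -480, -480],
   [-2400, -3840, -4292, 54365780, 16930032, 139014440, 1712804, -239159620, -10920, -15600, -10920, 0, -480, -620, -580, -600],
   [-2180, -3520, -4252, 9125710, 204608, 43582120, 236365100, 289599952, -958756, -1380680, -916356, -4654540, -1654460, -3065720, -3235500, -4082760],
   [0, 0, 0, 0, 36288, 51840, 36288, 28827414, 694924, -1666540, -4676, -9270, -2212, -2320, -868, 0],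
   [0, 0, 0, 0, 53592, 76560, 53592, 41546736, 3596336, 1425060, -4587912, -1812590, -8624, -9080, -3080, 0],
   [0, 0, 0, 17550, 6356, 126400, 88480, 28675350, 1351700, 6532520, 734076, -9596720, 0, 0, 0, 0],
   [-280, -380, -400, 22790, -1984, 30360, 42236, 139291276, 6565112, 11182140, 16059404, 15992760, -1089780, -2024840, -2147920, -2717660],
   [0, 0, 0, 3150, 980, 2240, 2240, 49184982, 2318004, 3294540, 2318484, 12356280, 2548352, -3508180, -477384, -208100],
   [0, 0, 0, 3510, 1092, 2520, 2632, 91107720, 4294220, 6133580, 4294640, 22915980, 10883956, 7133100, -5123148, -4058220],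
   [0, 0, 0, 3420, 1064, 2480, 2548, 96148404, 4531708, 6472300, 4532248, 24233580, 7677896, 19851940, 8803988, -12692980],
   [0, 0, 0, 3510, 1092, 2520, 2604, 121313214, 5717848, 8167040, 5718468, 30610260, 9646472, 21626980, 30185732, 13761580]]

/-- Multipliers of the inequalities at the minimizer, scaled by `2 * 10^7`. -/
def tabG : List ℤ :=
  [52738, 65232, 73180, 690760, 99096, 103954, 813184, 1152918766, 55960868, 80330590, 55935712, 271202834, 95835588, 177591582, 187568596, 236757320]

/-- Matrix of the first-order correction, scaled by `4 * 10^8`. -/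
def tabV : List (List ℤ) :=
  [[-41686523336, 0, 0, 0, 0, 0, 0, 0, 0, 0, 0, 0, 0, 0, 0, 0],
   [-46317118744, -46316335960, 0, 0, 0, 0, 0, 0, 0, 0, 0, 0, 0, 0, 0, 0],
   [2049040, -46314713400, -18525007200, 0, 0, 0, 0, 0, 0, 0, 0, 0, 0, 0, 0, 0],
   [19341280, 27630400, -46296835720, -162044451100, 0, 0, 0, 0, 0, 0, 0, 0, 0, 0, 0, 0],
   [2774688, 3963840, 2774688, -46293443160, -18518170032, 0, 0, 0, 0, 0, 0, 0, 0, 0, 0, 0],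
   [2910712, 4158160, 2910712, 9355860, -46297469168, -46296221720, 0, 0, 0, 0, 0, 0, 0, 0, 0, 0],
   [22769152, 32527360, 22769152, 73186560, 22769152, -46265773440, -18496551168, 0, 0, 0, 0, 0, 0, 0, 0, 0],
   [32281725448, 46116750640, 32281725448, 103762688940, 32281725448, 46116750640, -14000311672, -643460718340, 0, 0, 0, 0, 0, 0, 0, 0],
   [1566904304, 2238434720, 1566904304, 5036478120, 1566904304, 2238434720, 1566904304, 10017093792, -7722560416, 0, 0, 0, 0, 0, 0, 0],
   [2249256520, 3213223600, 2249256520, 7229753100, 2249256520, 3213223600, 2249256520, 47716370460, -19855187920, -18891220840, 0, 0, 0, 0, 0, 0],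
   [1566199936, 2237428480, 1566199936, 5034214080, 1566199936, 2237428480, 1566199936, 33225812928, 1566199936, -18260404160, -6632933120, 0, 0, 0, 0, 0],
   [7593679352, 10848113360, 7593679352, 24408255060, 7593679352, 10848113360, 7593679352, 161094483396, 7593679352, 10848113360, -11785439048, -43418659340, 0, 0, 0, 0],
   [2683396464, 3833423520, 2683396464, 8625202920, 2683396464, 3833423520, 2683396464, 56926339272, 2683396464, 3833423520, 2683396464, -5329858800, -2898628224, 0, 0, 0],
   [4972564296, 7103663280, 4972564296, 15983242380, 4972564296, 7103663280, 4972564296, 105489399708, 4972564296, 7103663280, 4972564296, 15983242380, -7065785664, -4934686680, 0, 0],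
   [5251920688, 7502743840, 5251920688, 16881173640, 5251920688, 7502743840, 5251920688, 111415746024, 5251920688, 7502743840, 5251920688, 16881173640, 5251920688, -983774480, 1857313360, 0],
   [6629204960, 9470292800, 6629204960, 21308158800, 6629204960, 9470292800, 6629204960, 140633848080, 6629204960, 9470292800, 6629204960, 21308158800, 6629204960, 9470292800, 1894058560, 4735146400]]

/-- Symmetrized row sums of `tabV`. -/
def tabR : List ℤ :=
  [-64845468576, -92632150064, -64836207960, -208280499940, -64800118056, -92572276364, -64572039552, -341561288128, 19194715512, 33229799880, 26791260608, 206235433588, 86840416272, 180153619380, 209074680440, 278900122960]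

/-- Approximate Cholesky factor of the form `tabT`. -/
def tabL0 : List (List ℤ) :=
  [[29662, -14175, -11150, -4082, -24, -34, -20, -35, -1, -2, -1, -1, 0, 0, 0, 0],
   [0, 31174, 21218, -51935, -47, -66, -39, -64, -2, -3, -2, -2, 0, 0, 0, 0],
   [0, 0, 37682, -37534, -17, -24, -14, -18, -1, -1, -1, 0, 0, 0, 0, 0],
   [0, 0, 0, 5739, 938, 906, 505, 5835, -43, -61, 195, 288, 43, 48, 46, 48],
   [0, 0, 0, 0, 8260, -7831, 1073, -1839, -42, -54, -125, -64, 7, 8, 8, 8],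
   [0, 0, 0, 0, 0, 2257, -2281, -2978, -382, -414, -62, -318, 88, 98, 96, 98],
   [0, 0, 0, 0, 0, 0, 18296, -15699, 95, 161, 418, 187, 19, 21, 21, 21],
   [0, 0, 0, 0, 0, 0, 0, 240054, 11611, 16739, 11585, 56087, 19801, 36677, 38706, 48837],
   [0, 0, 0, 0, 0, 0, 0, 0, 1666, -935, 77, 2524, 1015, 2010, 2210, 2857],
   [0, 0, 0, 0, 0, 0, 0, 0, 0, 1590, 338, 225, -1174, 280, 716, 1235],
   [0, 0, 0, 0, 0, 0, 0, 0, 0, 0, 3322, -1175, 833, 1298, 1326, 1641],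
   [0, 0, 0, 0, 0, 0, 0, 0, 0, 0, 0, 6601, 2235, 4302, 5071, 6761],
   [0, 0, 0, 0, 0, 0, 0, 0, 0, 0, 0, 0, 10404, -106, -5790, -3953],
   [0, 0, 0, 0, 0, 0, 0, 0, 0, 0, 0, 0, 0, 7472, 3268, -9644],
   [0, 0, 0, 0, 0, 0, 0, 0, 0, 0, 0, 0, 0, 0, 13575, -12969],
   [0, 0, 0, 0, 0, 0, 0, 0, 0, 0, 0, 0, 0, 0, 0, 5582]]

/-- Approximate Cholesky factor of the corrected form. -/
def tabL1 : List (List ℤ) :=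
  [[40358, -19343, -15204, -5626, -54, -76, -48, -151, 5, 9, 7, 67, 29, 59, 68, 91],
   [0, 42384, 28847, -70905, -102, -144, -91, -273, 9, 16, 13, 121, 52, 107, 124, 166],
   [0, 0, 51293, -51101, -25, -35, -21, -31, 0, 0, 0, 4, 2, 4, 4, 6],
   [0, 0, 0, 4204, 941, 393, -47, 8245, 307, 557, 1063, 5051, 1921, 3872, 4464, 5913],
   [0, 0, 0, 0, 11234, -10707, 1469, -2664, -66, -89, -197, -221, -42, -93, -110, -148],
   [0, 0, 0, 0, 0, 2724, -3726, -5018, -554, -578, -45, -117, 290, 470, 517, 643],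
   [0, 0, 0, 0, 0, 0, 24808, -21636, 121, 221, 601, 431, 109, 195, 219, 280],
   [0, 0, 0, 0, 0, 0, 0, 326662, 15802, 22781, 15762, 76310, 26942, 49899, 52655, 66432],
   [0, 0, 0, 0, 0, 0, 0, 0, 2262, -1450, -11, 2821, 1138, 2244, 2442, 3138],
   [0, 0, 0, 0, 0, 0, 0, 0, 0, 1916, 48, -1366, -2488, -953, -499, -227],
   [0, 0, 0, 0, 0, 0, 0, 0, 0, 0, 4443, -2742, 564, 929, 876, 1029],
   [0, 0, 0, 0, 0, 0, 0, 0, 0, 0, 0, 6970, 1882, 4437, 5401, 7296],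
   [0, 0, 0, 0, 0, 0, 0, 0, 0, 0, 0, 0, 14132, -168, -7892, -5369],
   [0, 0, 0, 0, 0, 0, 0, 0, 0, 0, 0, 0, 0, 10145, 4368, -13260],
   [0, 0, 0, 0, 0, 0, 0, 0, 0, 0, 0, 0, 0, 0, 18474, -17753],
   [0, 0, 0, 0, 0, 0, 0, 0, 0, 0, 0, 0, 0, 0, 0, 7012]]

/-- Entry of a table. -/
def ent (t : List (List ℤ)) (i j : Fin 16) : ℤ := (t.getD i.val []).getD j.val 0

/-- Entry of a row. -/
def ent1 (t : List ℤ) (i : Fin 16) : ℤ := t.getD i.val 0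

/-- Integer version (scaled by `20`) of the matrix of a weighted sum of interpolation forms. -/
def Tint (lam : Fin 16 → Fin 16 → ℤ) (a b : Fin 16) : ℤ :=
  2 * ent1 tabH b * ∑ i, lam i a * ((if b < a then 1 else 0) - (if b < i then 1 else 0))
    + (if a = b then 10 * ∑ j, (lam a j + lam j a) else 0) - 20 * lam a b

/-- Multipliers of the chain of consecutive iterates. -/
def chainC (i j : Fin 16) : ℤ :=
  if i.val = j.val + 1 then ∑ l, (if j < l then ent1 tabG l else 0) else 0

/-- The corrected form. -/
def X1 (a b : Fin 16) : ℤ :=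
  92640000000 * (20000000 * ent tabT a b + ent tabV a b) - ent1 tabR a * ent1 tabR b

/-- Residual of an approximate Cholesky factorization. -/
def resid (X : Fin 16 → Fin 16 → ℤ) (L : List (List ℤ)) (s : ℤ) (a b : Fin 16) : ℤ :=
  X a b + X b a - s * ∑ k, ent L k a * ent L k b

lemma tabA_nonneg : ∀ i j, 0 ≤ ent tabA i j := by decide +kernel

lemma tabA_flow : ∀ i : Fin 16, ∑ j, ent tabA i j - ∑ j, ent tabA j i =
    (if i = 0 then 1000000 else 0) - (if i = 15 then 1000000 else 0) := by decide +kernel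

lemma tabT_eq : ∀ a b, ent tabT a b = Tint (ent tabA) a b := by decide +kernel

lemma tabT_sum : ∑ a, ∑ b, ent tabT a b = 1158000000 := by decide +kernel

lemma tabG_eq : ∀ a, ent1 tabG a = ∑ b, (ent tabT a b + ent tabT b a) := by decide +kernel

lemma tabG_nonneg : ∀ a, 0 ≤ ent1 tabG a := by decide +kernel

lemma tabG_sum : ∑ a, ent1 tabG a = 2316000000 := by decide +kernel

lemma chainC_nonneg : ∀ i j, 0 ≤ chainC i j := by decide +kernel

lemma chainC_flow : ∀ i : Fin 16, ∑ j, chainC i j - ∑ j, chainC j i =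
    ent1 tabG i - (if i = 0 then 2316000000 else 0) := by decide +kernel

lemma tabV_eq : ∀ a b, ent tabV a b = Tint chainC a b +
    ent1 tabG a * ((if a = b then 10 else 0) + (if b < a then 2 * ent1 tabH b else 0)) := by
  decide +kernel

lemma tabV_sum : ∑ a, ∑ b, ent tabV a b = 23160000000 := by decide +kernel

lemma tabR_eq : ∀ a, ent1 tabR a = ∑ b, (ent tabV a b + ent tabV b a) := by decide +kernel

lemma dd0 : ∀ a, ∑ b, (if b = a then 0 else |resid (fun a b => 1000000 * ent tabT a b) tabL0 10000 a b|)
    ≤ resid (fun a b => 1000000 * ent tabT a b) tabL0 10000 a a := by decide +kernel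

lemma dd1 : ∀ a, ∑ b, (if b = a then 0 else |resid X1 tabL1 10000000000000000 a b|)
    ≤ resid X1 tabL1 10000000000000000 a a := by decide +kernel

section generic

variable {V : Type*} [NormedAddCommGroup V] [InnerProductSpace ℝ V]

/-- The quadratic form of a real matrix evaluated at a tuple of vectors. -/
def qf (M : Fin 16 → Fin 16 → ℝ) (v : Fin 16 → V) : ℝ :=
  ∑ a, ∑ b, M a b * inner ℝ (v a) (v b)

lemma qf_add (M M' : Fin 16 → Fin 16 → ℝ) (v : Fin 16 → V) :
    qf (fun a b => M a b + M' a b) v = qf M v + qf M' v := by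
  simp only [qf, add_mul, Finset.sum_add_distrib]

lemma qf_smul (c : ℝ) (M : Fin 16 → Fin 16 → ℝ) (v : Fin 16 → V) :
    qf (fun a b => c * M a b) v = c * qf M v := by
  simp only [qf, mul_assoc, Finset.mul_sum]

lemma qf_rank_one (r : Fin 16 → ℝ) (v : Fin 16 → V) :
    qf (fun a b => r a * r b) v = ‖∑ a, r a • v a‖ ^ 2 := by
  rw [← real_inner_self_eq_norm_sq, sum_inner]
  simp only [qf, inner_sum, real_inner_smul_left, real_inner_smul_right]
  refine Finset.sum_congr rfl fun a _ => Finset.sum_congr rfl fun b _ => ?_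
  ring

lemma qf_transpose (M : Fin 16 → Fin 16 → ℝ) (v : Fin 16 → V) :
    qf (fun a b => M b a) v = qf M v := by
  unfold qf
  rw [Finset.sum_comm]
  refine Finset.sum_congr rfl fun a _ => Finset.sum_congr rfl fun b _ => ?_
  rw [real_inner_comm]

lemma qf_shift (M : Fin 16 → Fin 16 → ℝ) (u : V) (d : Fin 16 → V) :
    qf M (fun a => u + d a) = (∑ a, ∑ b, M a b) * ‖u‖ ^ 2
      + inner ℝ u (∑ a, (∑ b, (M a b + M b a)) • d a) + qf M d := by
  have h1 : inner ℝ u (∑ a, (∑ b, (M a b + M b a)) • d a)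
      = ∑ a, ∑ b, M a b * (inner ℝ u (d a) + inner ℝ u (d b)) := by
    simp only [inner_sum, real_inner_smul_right, Finset.sum_mul, add_mul, mul_add,
      Finset.sum_add_distrib]
    congr 1
    rw [Finset.sum_comm]
  rw [h1]
  simp only [qf, Finset.sum_mul, ← Finset.sum_add_distrib]
  refine Finset.sum_congr rfl fun a _ => Finset.sum_congr rfl fun b _ => ?_
  rw [inner_add_left, inner_add_right, inner_add_right, real_inner_self_eq_norm_sq,
    real_inner_comm u (d a)]
  ring

/-- Symmetric diagonally dominant matrices give nonnegative forms. -/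
lemma qf_nonneg_of_dd (R : Fin 16 → Fin 16 → ℝ) (hs : ∀ a b, R a b = R b a)
    (hd : ∀ a, ∑ b, (if b = a then 0 else |R a b|) ≤ R a a) (v : Fin 16 → V) :
    0 ≤ qf R v := by
  have key : ∀ a b, (if b = a then (R a a) * ‖v a‖ ^ 2 else
      - (|R a b| * ((‖v a‖ ^ 2 + ‖v b‖ ^ 2) / 2))) ≤ R a b * inner ℝ (v a) (v b) := by
    intro a b
    split_ifs with h
    · subst h; rw [real_inner_self_eq_norm_sq]
    · have h1 := abs_real_inner_le_norm (v a) (v b)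
      have h2 : ‖v a‖ * ‖v b‖ ≤ (‖v a‖ ^ 2 + ‖v b‖ ^ 2) / 2 := by
        nlinarith [sq_nonneg (‖v a‖ - ‖v b‖)]
      have h3 : |R a b * inner ℝ (v a) (v b)| ≤ |R a b| * ((‖v a‖ ^ 2 + ‖v b‖ ^ 2) / 2) := by
        rw [abs_mul]; exact mul_le_mul_of_nonneg_left (h1.trans h2) (abs_nonneg _)
      exact (abs_le.mp h3).1
  have h2 : ∑ a, ∑ b, (if b = a then (R a a) * ‖v a‖ ^ 2 else
      - (|R a b| * ((‖v a‖ ^ 2 + ‖v b‖ ^ 2) / 2))) ≤ qf R v :=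
    Finset.sum_le_sum fun a _ => Finset.sum_le_sum fun b _ => key a b
  refine le_trans ?_ h2
  have h3 : ∀ a b, (if b = a then (R a a) * ‖v a‖ ^ 2 else
      - (|R a b| * ((‖v a‖ ^ 2 + ‖v b‖ ^ 2) / 2)))
      = (if b = a then R a a * ‖v a‖ ^ 2 else 0)
        - (if b = a then 0 else |R a b|) * ‖v a‖ ^ 2 / 2
        - (if b = a then 0 else |R a b|) * ‖v b‖ ^ 2 / 2 := by
    intro a b
    split_ifs <;> ring
  have h4 : ∑ a, ∑ b, (if b = a then 0 else |R a b|) * ‖v b‖ ^ 2 / 2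
      = ∑ a, ∑ b, (if b = a then 0 else |R a b|) * ‖v a‖ ^ 2 / 2 := by
    rw [Finset.sum_comm]
    refine Finset.sum_congr rfl fun a _ => Finset.sum_congr rfl fun b _ => ?_
    rw [hs b a]
    simp only [eq_comm]
  simp only [h3, Finset.sum_sub_distrib]
  rw [h4, ← Finset.sum_sub_distrib, ← Finset.sum_sub_distrib]
  refine Finset.sum_nonneg fun a _ => ?_
  rw [Finset.sum_ite_eq' Finset.univ a, if_pos (Finset.mem_univ a), ← Finset.sum_div,
    ← Finset.sum_mul]
  nlinarith [hd a, sq_nonneg ‖v a‖, mul_le_mul_of_nonneg_right (hd a) (sq_nonneg ‖v a‖)]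

lemma qf_nonneg_of_cert (X : Fin 16 → Fin 16 → ℤ) (L : List (List ℤ)) (s : ℤ) (hs : 0 ≤ s)
    (hd : ∀ a, ∑ b, (if b = a then 0 else |resid X L s a b|) ≤ resid X L s a a)
    (v : Fin 16 → V) : 0 ≤ qf (fun a b => (X a b : ℝ)) v := by
  have h1 : 0 ≤ qf (fun a b => (resid X L s a b : ℝ)) v := by
    refine qf_nonneg_of_dd _ ?_ ?_ v
    · intro a b
      congr 1
      unfold resid
      rw [add_comm (X a b)]
      congr 2
      exact Finset.sum_congr rfl fun k _ => mul_comm _ _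
    · intro a
      have := hd a
      have h2 : ((∑ b, (if b = a then 0 else |resid X L s a b|) : ℤ) : ℝ) ≤ (resid X L s a a : ℝ) := by
        exact_mod_cast this
      refine le_trans (le_of_eq ?_) h2
      push_cast
      refine Finset.sum_congr rfl fun b _ => ?_
      split_ifs <;> simp
  have h2 : 0 ≤ qf (fun a b => ∑ k, (ent L k a : ℝ) * (ent L k b : ℝ)) v := by
    have : qf (fun a b => ∑ k, (ent L k a : ℝ) * (ent L k b : ℝ)) v
        = ∑ k, qf (fun a b => (ent L k a : ℝ) * (ent L k b : ℝ)) v := by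
      simp only [qf, Finset.sum_mul]
      rw [Finset.sum_comm]
      have : ∀ a : Fin 16, ∑ b, ∑ k, (ent L k a : ℝ) * (ent L k b : ℝ) * inner ℝ (v a) (v b)
        = ∑ k, ∑ b, (ent L k a : ℝ) * (ent L k b : ℝ) * inner ℝ (v a) (v b) :=
          fun a => Finset.sum_comm
      rw [Finset.sum_comm]
      simp only [this]
      rw [Finset.sum_comm]
    rw [this]
    refine Finset.sum_nonneg fun k _ => ?_
    rw [qf_rank_one (fun a => (ent L k a : ℝ))]
    positivity
  have h3 : qf (fun a b => (X a b : ℝ) + (X b a : ℝ)) v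
      = qf (fun a b => (resid X L s a b : ℝ)) v
        + s * qf (fun a b => ∑ k, (ent L k a : ℝ) * (ent L k b : ℝ)) v := by
    rw [← qf_smul, ← qf_add]
    congr 1
    funext a b
    unfold resid
    push_cast
    ring
  rw [qf_add, qf_transpose (fun a b => (X a b : ℝ))] at h3
  have hs' : (0 : ℝ) ≤ s := by exact_mod_cast hs
  nlinarith [mul_nonneg hs' h2]

/-- Matrix of the quadratic form of a weighted sum of interpolation inequalities. -/
def Tm (h : Fin 16 → ℝ) (lam : Fin 16 → Fin 16 → ℝ) (a b : Fin 16) : ℝ :=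
  h b * ∑ i, lam i a * ((if b < a then 1 else 0) - (if b < i then 1 else 0))
    + (if a = b then (∑ j, (lam a j + lam j a)) / 2 else 0) - lam a b

lemma edge_sum (h : Fin 16 → ℝ) (lam : Fin 16 → Fin 16 → ℝ) (x g : Fin 16 → V) (x0 : V)
    (hx : ∀ i, x i = x0 - ∑ k, ((if k < i then 1 else 0) * h k) • g k) :
    ∑ i, ∑ j, lam i j * (inner ℝ (g j) (x i - x j) + ‖g i - g j‖ ^ 2 / 2)
      = qf (Tm h lam) g := by
  have e1 : ∀ i j, inner ℝ (g j) (x i - x j)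
      = ∑ k, h k * ((if k < j then 1 else 0) - (if k < i then 1 else 0)) * inner ℝ (g j) (g k) := by
    intro i j
    have : x i - x j = ∑ k, (h k * ((if k < j then 1 else 0) - (if k < i then 1 else 0))) • g k := by
      rw [hx i, hx j, sub_sub_sub_cancel_left, ← Finset.sum_sub_distrib]
      refine Finset.sum_congr rfl fun k _ => ?_
      rw [← sub_smul]; congr 1; ring
    rw [this, inner_sum]
    simp only [real_inner_smul_right]
  have e2 : ∀ i j, ‖g i - g j‖ ^ 2 / 2
      = inner ℝ (g i) (g i) / 2 + inner ℝ (g j) (g j) / 2 - inner ℝ (g i) (g j) := by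
    intro i j
    rw [norm_sub_sq_real, real_inner_self_eq_norm_sq, real_inner_self_eq_norm_sq]; ring
  have r1 : qf (Tm h lam) g
      = ∑ a, ∑ b, ∑ i, lam i a * (h b * ((if b < a then 1 else 0) - (if b < i then 1 else 0))
          * inner ℝ (g a) (g b))
        + ∑ a, ∑ j, (lam a j + lam j a) / 2 * inner ℝ (g a) (g a)
        - ∑ a, ∑ b, lam a b * inner ℝ (g a) (g b) := by
    simp only [qf, Tm, add_mul, sub_mul, Finset.sum_add_distrib, Finset.sum_sub_distrib]
    congr 1
    congr 1
    · refine Finset.sum_congr rfl fun a _ => Finset.sum_congr rfl fun b _ => ?_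
      rw [Finset.mul_sum, Finset.sum_mul]
      refine Finset.sum_congr rfl fun i _ => ?_
      ring
    · refine Finset.sum_congr rfl fun a _ => ?_
      simp only [ite_mul, zero_mul, Finset.sum_ite_eq, Finset.mem_univ, if_true]
      rw [← Finset.sum_add_distrib, Finset.sum_div, Finset.sum_mul]
  rw [r1]
  simp only [e1, e2, mul_add, mul_sub, Finset.sum_add_distrib, Finset.sum_sub_distrib]
  have s1 : ∑ i, ∑ j, lam i j * ∑ k, h k * ((if k < j then 1 else 0) - (if k < i then 1 else 0))
        * inner ℝ (g j) (g k)
      = ∑ a, ∑ b, ∑ i, lam i a * (h b * ((if b < a then 1 else 0) - (if b < i then 1 else 0))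
          * inner ℝ (g a) (g b)) := by
    rw [Finset.sum_comm]
    refine Finset.sum_congr rfl fun a _ => ?_
    rw [Finset.sum_comm]
    refine Finset.sum_congr rfl fun i _ => ?_
    rw [Finset.mul_sum]
  have s2 : ∑ a, ∑ j, (lam a j + lam j a) / 2 * inner ℝ (g a) (g a)
      = ∑ i, ∑ j, lam i j * (inner ℝ (g i) (g i) / 2)
        + ∑ i, ∑ j, lam i j * (inner ℝ (g j) (g j) / 2) := by
    rw [Finset.sum_comm (f := fun i j => lam i j * (inner ℝ (g j) (g j) / 2)),
      ← Finset.sum_add_distrib]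
    refine Finset.sum_congr rfl fun a _ => ?_
    rw [← Finset.sum_add_distrib]
    refine Finset.sum_congr rfl fun b _ => ?_
    ring
  simp only [mul_sub] at s1
  rw [s1, s2]
  ring

lemma flow_sum (lam : Fin 16 → Fin 16 → ℝ) (F : Fin 16 → ℝ) :
    ∑ i, ∑ j, lam i j * (F i - F j) = ∑ i, (∑ j, lam i j - ∑ j, lam j i) * F i := by
  simp only [mul_sub, sub_mul, Finset.sum_sub_distrib, Finset.sum_mul]
  congr 1
  rw [Finset.sum_comm]

lemma weighted (h : Fin 16 → ℝ) (lam : Fin 16 → Fin 16 → ℝ) (hl : ∀ i j, 0 ≤ lam i j)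
    (x g : Fin 16 → V) (x0 : V) (F : Fin 16 → ℝ)
    (hx : ∀ i, x i = x0 - ∑ k, ((if k < i then 1 else 0) * h k) • g k)
    (hQ : ∀ i j, F j + inner ℝ (g j) (x i - x j) + ‖g i - g j‖ ^ 2 / 2 ≤ F i) :
    qf (Tm h lam) g ≤ ∑ i, (∑ j, lam i j - ∑ j, lam j i) * F i := by
  rw [← edge_sum h lam x g x0 hx, ← flow_sum]
  refine Finset.sum_le_sum fun i _ => Finset.sum_le_sum fun j _ => ?_
  refine mul_le_mul_of_nonneg_left ?_ (hl i j)
  linarith [hQ i j]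

end generic

section core

variable {V : Type*} [NormedAddCommGroup V] [InnerProductSpace ℝ V]

/-- The stepsizes as real numbers. -/
def hh (k : Fin 16) : ℝ := (ent1 tabH k : ℝ) / 10

lemma Tm_int (c : ℝ) (hc : c ≠ 0) (A : Fin 16 → Fin 16 → ℤ) (a b : Fin 16) :
    Tm hh (fun i j => (A i j : ℝ) / c) a b = (Tint A a b : ℝ) / (20 * c) := by
  have e1 : ∑ i, (A i a : ℝ) / c * ((if b < a then 1 else 0) - (if b < i then 1 else 0))
      = (∑ i, (A i a : ℝ) * ((if b < a then 1 else 0) - (if b < i then 1 else 0))) / c := by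
    rw [Finset.sum_div]
    refine Finset.sum_congr rfl fun i _ => ?_
    ring
  have e2 : ∑ j, ((A a j : ℝ) / c + (A j a : ℝ) / c) = (∑ j, ((A a j : ℝ) + A j a)) / c := by
    rw [Finset.sum_div]
    refine Finset.sum_congr rfl fun i _ => ?_
    ring
  unfold Tm Tint hh
  rw [e1, e2]
  push_cast
  split_ifs <;> field_simp <;> ring

/-- Symmetric part of the mixed term. -/
lemma T0_shift (u : V) (g : Fin 16 → V) :
    qf (fun a b => (ent tabT a b : ℝ) / 20000000) g
      = qf (fun a b => (ent tabT a b : ℝ) / 20000000) (fun a => g a - u)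
        + inner ℝ u (∑ a, ((ent1 tabG a : ℝ) / 20000000) • g a) - 579 / 10 * ‖u‖ ^ 2 := by
  have h := qf_shift (fun a b => (ent tabT a b : ℝ) / 20000000) u (fun a => g a - u)
  simp only [add_sub_cancel] at h
  have hS : ∑ a, ∑ b, (ent tabT a b : ℝ) / 20000000 = 579 / 10 := by
    simp only [← Finset.sum_div]
    have := tabT_sum
    have h2 : ((∑ a, ∑ b, ent tabT a b : ℤ) : ℝ) = 1158000000 := by rw [this]; norm_num
    push_cast at h2
    rw [h2]; norm_num
  have hG : ∀ a, ∑ b, ((ent tabT a b : ℝ) / 20000000 + (ent tabT b a : ℝ) / 20000000)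
      = (ent1 tabG a : ℝ) / 20000000 := by
    intro a
    rw [tabG_eq a]
    push_cast
    rw [Finset.sum_div]
    refine Finset.sum_congr rfl fun b _ => ?_
    ring
  have hGs : ∑ a, (ent1 tabG a : ℝ) / 20000000 = 2 * (579 / 10) := by
    rw [← Finset.sum_div]
    have h2 : ((∑ a, ent1 tabG a : ℤ) : ℝ) = 2316000000 := by rw [tabG_sum]; norm_num
    push_cast at h2
    rw [h2]; norm_num
  simp only [hS, hG, smul_sub, Finset.sum_sub_distrib] at h
  rw [h, inner_sub_right, ← Finset.sum_smul, hGs, real_inner_smul_right,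
    real_inner_self_eq_norm_sq]
  ring

lemma P0 (d : Fin 16 → V) : 0 ≤ qf (fun a b => (ent tabT a b : ℝ) / 20000000) d := by
  have h := qf_nonneg_of_cert _ tabL0 10000 (by norm_num) dd0 d
  have e : qf (fun a b => (((1000000 * ent tabT a b : ℤ)) : ℝ)) d
      = 20000000000000 * qf (fun a b => (ent tabT a b : ℝ) / 20000000) d := by
    rw [← qf_smul]
    congr 1
    funext a b
    push_cast
    ring
  rw [e] at h
  linarith

lemma P1 (u : V) (g : Fin 16 → V) :
    0 ≤ qf (fun a b => (ent tabT a b : ℝ) / 20000000) (fun a => g a - u)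
      + 1 / 1000000 * qf (fun a b => (ent tabV a b : ℝ) / 400000000) g := by
  have h := qf_shift (fun a b => (ent tabV a b : ℝ) / 400000000) u (fun a => g a - u)
  simp only [add_sub_cancel] at h
  have hS : ∑ a, ∑ b, (ent tabV a b : ℝ) / 400000000 = 579 / 10 := by
    simp only [← Finset.sum_div]
    have h2 : ((∑ a, ∑ b, ent tabV a b : ℤ) : ℝ) = 23160000000 := by rw [tabV_sum]; norm_num
    push_cast at h2
    rw [h2]; norm_num
  have hG : ∀ a, ∑ b, ((ent tabV a b : ℝ) / 400000000 + (ent tabV b a : ℝ) / 400000000)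
      = (ent1 tabR a : ℝ) / 400000000 := by
    intro a
    rw [tabR_eq a]
    push_cast
    rw [Finset.sum_div]
    refine Finset.sum_congr rfl fun b _ => ?_
    ring
  simp only [hS, hG] at h
  rw [h]
  set d : Fin 16 → V := fun a => g a - u
  have hr := qf_rank_one (fun a => (ent1 tabR a : ℝ) / 400000000) d
  set w : V := ∑ a, ((ent1 tabR a : ℝ) / 400000000) • d a
  have hc := qf_nonneg_of_cert X1 tabL1 10000000000000000 (by norm_num) dd1 d
  have e : qf (fun a b => (X1 a b : ℝ)) d
      = 92640000000 * 400000000 * 1000000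
        * (qf (fun a b => (ent tabT a b : ℝ) / 20000000) d
          + (1 / 1000000) * (qf (fun a b => (ent tabV a b : ℝ) / 400000000) d
          + (- (10 / 2316)) * qf (fun a b => (ent1 tabR a : ℝ) / 400000000
              * ((ent1 tabR b : ℝ) / 400000000)) d)) := by
    rw [← qf_smul (- (10 / 2316)), ← qf_add, ← qf_smul (1 / 1000000), ← qf_add, ← qf_smul]
    congr 1
    funext a b
    unfold X1
    push_cast
    ring
  rw [e, hr] at hc
  have hsq : 0 ≤ 579 / 10 * ‖u‖ ^ 2 + inner ℝ u w + 10 / 2316 * ‖w‖ ^ 2 := by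
    have h1 := abs_le.mp (abs_real_inner_le_norm u w)
    nlinarith [sq_nonneg (‖u‖ * 1158 - ‖w‖ * 10), h1.1, norm_nonneg u, norm_nonneg w]
  nlinarith [hsq, hc]

lemma core (x g : Fin 16 → V) (F : Fin 16 → ℝ) (δ : ℝ) (h0 : 0 ≤ δ) (h1 : δ ≤ 1 / 1000000)
    (hx : ∀ i, x i = x 0 - ∑ k, ((if k < i then 1 else 0) * hh k) • g k)
    (hQ : ∀ i j, F j + inner ℝ (g j) (x i - x j) + ‖g i - g j‖ ^ 2 / 2 ≤ F i)
    (hS : ∀ j, F j - inner ℝ (g j) (x j) + ‖g j‖ ^ 2 / 2 ≤ 0)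
    (hD : ‖x 0‖ ≤ 1) (hF : F 0 ≤ δ) : F 15 ≤ δ - 579 / 10 * δ ^ 2 := by
  -- first inequality
  have I1 := weighted hh (fun i j => (ent tabA i j : ℝ) / 1000000)
    (fun i j => div_nonneg (by exact_mod_cast tabA_nonneg i j) (by norm_num)) x g (x 0) F hx hQ
  have T1 : Tm hh (fun i j => (ent tabA i j : ℝ) / 1000000)
      = fun a b => (ent tabT a b : ℝ) / 20000000 := by
    funext a b
    rw [Tm_int _ (by norm_num), tabT_eq]; norm_num
  have F1 : ∑ i, (∑ j, (ent tabA i j : ℝ) / 1000000 - ∑ j, (ent tabA j i : ℝ) / 1000000) * F i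
      = F 0 - F 15 := by
    have : ∀ i, (∑ j, (ent tabA i j : ℝ) / 1000000 - ∑ j, (ent tabA j i : ℝ) / 1000000)
        = (if i = 0 then 1 else 0) - (if i = 15 then 1 else 0) := by
      intro i
      have h2 : ((∑ j, ent tabA i j - ∑ j, ent tabA j i : ℤ) : ℝ)
        = ((if i = 0 then 1000000 else 0) - (if i = 15 then 1000000 else 0) : ℤ) := by
          rw [tabA_flow i]
      push_cast at h2
      rw [← Finset.sum_div, ← Finset.sum_div, ← sub_div, h2, sub_div]
      congr 1 <;> split_ifs <;> norm_num
    simp only [this, sub_mul, ite_mul, one_mul, zero_mul, Finset.sum_sub_distrib,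
      Finset.sum_ite_eq', Finset.mem_univ, if_true]
  rw [T1, F1] at I1
  -- second inequality
  have I2 := weighted hh (fun i j => (chainC i j : ℝ) / 20000000)
    (fun i j => div_nonneg (by exact_mod_cast chainC_nonneg i j) (by norm_num)) x g (x 0) F hx hQ
  have F2 : ∑ i, (∑ j, (chainC i j : ℝ) / 20000000 - ∑ j, (chainC j i : ℝ) / 20000000) * F i
      = ∑ i, (ent1 tabG i : ℝ) / 20000000 * F i - 2 * (579 / 10) * F 0 := by
    have : ∀ i, (∑ j, (chainC i j : ℝ) / 20000000 - ∑ j, (chainC j i : ℝ) / 20000000)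
        = (ent1 tabG i : ℝ) / 20000000 - (if i = 0 then 2 * (579 / 10) else 0) := by
      intro i
      have h2 : ((∑ j, chainC i j - ∑ j, chainC j i : ℤ) : ℝ)
        = (ent1 tabG i - (if i = 0 then 2316000000 else 0) : ℤ) := by
          rw [chainC_flow i]
      push_cast at h2
      rw [← Finset.sum_div, ← Finset.sum_div, ← sub_div, h2, sub_div]
      congr 1
      split_ifs <;> norm_num
    simp only [this, sub_mul, ite_mul, zero_mul, Finset.sum_sub_distrib,
      Finset.sum_ite_eq', Finset.mem_univ, if_true]
  rw [F2] at I2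
  -- third inequality
  have I3 : ∑ j, (ent1 tabG j : ℝ) / 20000000 * (F j - inner ℝ (g j) (x j) + ‖g j‖ ^ 2 / 2) ≤ 0 :=
    Finset.sum_nonpos fun j _ => mul_nonpos_of_nonneg_of_nonpos
      (div_nonneg (by exact_mod_cast tabG_nonneg j) (by norm_num)) (hS j)
  have W3 : ∑ j, (ent1 tabG j : ℝ) / 20000000 * (F j - inner ℝ (g j) (x j) + ‖g j‖ ^ 2 / 2)
      = ∑ j, (ent1 tabG j : ℝ) / 20000000 * F j
        - inner ℝ (x 0) (∑ a, ((ent1 tabG a : ℝ) / 20000000) • g a)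
        + qf (fun a b => (ent1 tabG a : ℝ) / 20000000
          * ((if a = b then 1 / 2 else 0) + (if b < a then hh b else 0))) g := by
    simp only [qf, inner_sum, real_inner_smul_right]
    rw [← Finset.sum_sub_distrib, ← Finset.sum_add_distrib]
    refine Finset.sum_congr rfl fun j _ => ?_
    have e1 : inner ℝ (g j) (x j) = inner ℝ (x 0) (g j)
        - ∑ b, (if b < j then hh b else 0) * inner ℝ (g j) (g b) := by
      rw [hx j, inner_sub_right, inner_sum, real_inner_comm]
      congr 1
      refine Finset.sum_congr rfl fun b _ => ?_
      rw [real_inner_smul_right]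
      split_ifs <;> ring
    have e2 : ∑ b, (ent1 tabG j : ℝ) / 20000000
          * ((if j = b then 1 / 2 else 0) + (if b < j then hh b else 0)) * inner ℝ (g j) (g b)
        = (ent1 tabG j : ℝ) / 20000000 * (‖g j‖ ^ 2 / 2
          + ∑ b, (if b < j then hh b else 0) * inner ℝ (g j) (g b)) := by
      have e3 : ‖g j‖ ^ 2 / 2 = ∑ b, (if j = b then 1 / 2 else 0) * inner ℝ (g j) (g b) := by
        simp only [ite_mul, zero_mul, Finset.sum_ite_eq, Finset.mem_univ, if_true]
        rw [real_inner_self_eq_norm_sq]; ring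
      rw [e3, ← Finset.sum_add_distrib, Finset.mul_sum]
      refine Finset.sum_congr rfl fun b _ => ?_
      ring
    rw [e1, e2]
    ring
  have T2 : qf (Tm hh (fun i j => (chainC i j : ℝ) / 20000000)) g
      + qf (fun a b => (ent1 tabG a : ℝ) / 20000000
          * ((if a = b then 1 / 2 else 0) + (if b < a then hh b else 0))) g
      = qf (fun a b => (ent tabV a b : ℝ) / 400000000) g := by
    rw [← qf_add]
    congr 1
    funext a b
    rw [Tm_int _ (by norm_num), tabV_eq]
    push_cast
    unfold hh
    split_ifs <;> ring
  rw [W3] at I3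
  -- combine
  have hp0 := P0 (fun a => g a - δ • x 0)
  have hp1 := P1 (δ • x 0) g
  have hsh := T0_shift (δ • x 0) g
  rw [real_inner_smul_left, norm_smul, Real.norm_of_nonneg h0] at hsh
  set G := inner ℝ (x 0) (∑ a, ((ent1 tabG a : ℝ) / 20000000) • g a)
  set Q0 := qf (fun a b => (ent tabT a b : ℝ) / 20000000) (fun a => g a - δ • x 0)
  set Q := qf (fun a b => (ent tabV a b : ℝ) / 400000000) g
  set SF := ∑ i, (ent1 tabG i : ℝ) / 20000000 * F i
  have I23 : Q + 2 * (579 / 10) * F 0 - G ≤ 0 := by linarith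
  have m1 := mul_le_mul_of_nonneg_left I23 h0
  have hb : 0 ≤ Q0 + δ * Q := by
    have a1 : 0 ≤ (1 - 1000000 * δ) * Q0 := mul_nonneg (by linarith) hp0
    have a2 : 0 ≤ (1000000 * δ) * (Q0 + 1 / 1000000 * Q) := mul_nonneg (by linarith) hp1
    linarith
  have hn : (δ * ‖x 0‖) ^ 2 ≤ δ ^ 2 := by
    rw [mul_pow]
    have : ‖x 0‖ ^ 2 ≤ 1 := by nlinarith [norm_nonneg (x 0)]
    nlinarith [sq_nonneg δ]
  have hv : (1 - 2 * (579 / 10) * δ) * F 0 ≤ (1 - 2 * (579 / 10) * δ) * δ :=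
    mul_le_mul_of_nonneg_left hF (by linarith)
  nlinarith [hsh, I1, m1, hb, hn, hv]

end core

section smooth

variable {n : ℕ}

lemma hasDerivAt_line {f : E n → ℝ} (hf : Differentiable ℝ f) (x v : E n) (t : ℝ) :
    HasDerivAt (fun s : ℝ => f (x + s • v)) (inner ℝ (gradient f (x + t • v)) v) t := by
  have h1 : HasDerivAt (fun s : ℝ => x + s • v) v t := by
    simpa using ((hasDerivAt_id t).smul_const v).const_add x
  have h2 := (hf (x + t • v)).hasFDerivAt.comp_hasDerivAt t h1
  rw [inner_gradient_left]
  exact h2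

lemma first_order {f : E n → ℝ} (hf : Differentiable ℝ f) (hc : ConvexOn ℝ Set.univ f)
    (x y : E n) : f x + inner ℝ (gradient f x) (y - x) ≤ f y := by
  have hp : ConvexOn ℝ Set.univ (fun s : ℝ => f (x + s • (y - x))) := by
    refine ⟨convex_univ, fun a _ b _ p q hp hq hpq => ?_⟩
    have := hc.2 (Set.mem_univ (x + a • (y - x))) (Set.mem_univ (x + b • (y - x))) hp hq hpq
    refine le_trans (le_of_eq ?_) this
    have hq' : q = 1 - p := by linarith
    have e : x + (p • a + q • b) • (y - x)
        = p • (x + a • (y - x)) + q • (x + b • (y - x)) := by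
      rw [hq']
      simp only [smul_eq_mul]
      module
    exact congrArg f e
  have hd := hasDerivAt_line hf x (y - x) 0
  have := hp.le_slope_of_hasDerivAt (Set.mem_univ 0) (Set.mem_univ 1) one_pos hd
  simp only [slope_def_field, zero_smul, add_zero, one_smul, sub_zero, div_one,
    add_sub_cancel] at this
  linarith

lemma descent {f : E n → ℝ} {L : ℝ} (hf : IsLSmooth L f) (y v : E n) :
    f (y + v) ≤ f y + inner ℝ (gradient f y) v + L / 2 * ‖v‖ ^ 2 := by
  have hd : ∀ t : ℝ, HasDerivAt
      (fun s : ℝ => f (y + s • v) - s * inner ℝ (gradient f y) v - L / 2 * ‖v‖ ^ 2 * s ^ 2)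
      (inner ℝ (gradient f (y + t • v)) v - inner ℝ (gradient f y) v - L * ‖v‖ ^ 2 * t) t := by
    intro t
    have h1 := hasDerivAt_line hf.1 y v t
    have h2 := (hasDerivAt_id t).mul_const (inner ℝ (gradient f y) v)
    have h3 := (hasDerivAt_pow 2 t).const_mul (L / 2 * ‖v‖ ^ 2)
    refine ((h1.sub h2).sub h3).congr_deriv ?_
    push_cast
    ring
  have ha : AntitoneOn
      (fun s : ℝ => f (y + s • v) - s * inner ℝ (gradient f y) v - L / 2 * ‖v‖ ^ 2 * s ^ 2)
      (Set.Icc 0 1) := by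
    refine antitoneOn_of_deriv_nonpos (convex_Icc 0 1)
      (fun t _ => (hd t).continuousAt.continuousWithinAt)
      (fun t _ => (hd t).differentiableAt.differentiableWithinAt) ?_
    intro t ht
    rw [interior_Icc] at ht
    rw [(hd t).deriv, ← inner_sub_left]
    have h1 := real_inner_le_norm (gradient f (y + t • v) - gradient f y) v
    have h2 := hf.2 (y + t • v) y
    rw [add_sub_cancel_left, norm_smul, Real.norm_of_nonneg ht.1.le] at h2
    nlinarith [norm_nonneg v, mul_le_mul_of_nonneg_right h2 (norm_nonneg v)]
  have := ha (Set.left_mem_Icc.mpr zero_le_one) (Set.right_mem_Icc.mpr zero_le_one) zero_le_one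
  simp only [one_smul, zero_smul, add_zero] at this
  linarith

lemma interp {f : E n → ℝ} {L : ℝ} (hL : 0 < L) (hc : ConvexOn ℝ Set.univ f)
    (hf : IsLSmooth L f) (x y : E n) :
    f x + inner ℝ (gradient f x) (y - x) + 1 / (2 * L) * ‖gradient f y - gradient f x‖ ^ 2
      ≤ f y := by
  set w := gradient f y - gradient f x with hw
  have h1 := descent hf y (-(1 / L) • w)
  have h2 := first_order hf.1 hc x (y + -(1 / L) • w)
  have e : y + -(1 / L) • w - x = (y - x) + -(1 / L) • w := by abel
  rw [e, inner_add_right, real_inner_smul_right] at h2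
  rw [real_inner_smul_right, norm_smul, Real.norm_eq_abs, abs_neg,
    abs_of_pos (by positivity : 0 < 1 / L)] at h1
  have h3 : inner ℝ (gradient f y) w = inner ℝ (gradient f x) w + ‖w‖ ^ 2 := by
    rw [← real_inner_self_eq_norm_sq w]
    rw [← inner_add_left, hw, add_sub_cancel]
  rw [h3] at h1
  have e2 : L / 2 * (1 / L * ‖w‖) ^ 2 = 1 / (2 * L) * ‖w‖ ^ 2 := by field_simp
  have e3 : -(1 / L) * ‖w‖ ^ 2 = - (2 * (1 / (2 * L) * ‖w‖ ^ 2)) := by field_simp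
  rw [e2] at h1
  linarith

lemma grad_min {f : E n → ℝ} {xs : E n} (hm : ∀ z, f xs ≤ f z) : gradient f xs = 0 := by
  have : IsLocalMin f xs := Filter.Eventually.of_forall hm
  unfold gradient
  rw [this.fderiv_eq_zero, map_zero]

end smooth

/-- The stepsizes are those of the statement. -/
lemma hh_eq : ∀ k : Fin 16, k.val < 15 → hh k =
    (if k.val % 15 = 7 then 297 / 10
      else if k.val % 15 = 3 ∨ k.val % 15 = 11 then 9 / 2
      else if k.val % 15 % 2 = 1 then 2
      else 7 / 5 : ℝ) := by
  intro k hk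
  unfold hh ent1 tabH
  revert hk
  fin_cases k <;> norm_num

lemma straight0 (h : ℕ → ℝ) (hh' : ∀ k : Fin 16, k.val < 15 → hh k = h k.val)
    (n : ℕ) (L D δ : ℝ) (hL : 0 < L) (hD : 0 < D) (h0 : 0 ≤ δ) (h1 : δ ≤ L * D ^ 2 * 1e-6)
    (g : E n → ℝ) (hc : ConvexOn ℝ Set.univ g) (hg : IsLSmooth L g) (ys : E n)
    (hm : ∀ z, g ys ≤ g z) (y : ℕ → E n) (hy0 : ‖y 0 - ys‖ ≤ D) (hgy : g (y 0) - g ys ≤ δ)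
    (hy : ∀ k < 15, y (k + 1) = y k - (h k / L) • gradient g (y k)) :
    g (y 15) - g ys ≤ δ - 579 / 10 / (L * D ^ 2) * δ ^ 2 := by
  have hLD : 0 < L * D ^ 2 := by positivity
  have hsum : ∀ i ≤ 15, y i = y 0 - ∑ k ∈ Finset.range i, (h k / L) • gradient g (y k) := by
    intro i
    induction i with
    | zero => simp
    | succ i ih =>
      intro hi
      rw [hy i (by omega), Finset.sum_range_succ, ← sub_sub, ← ih (by omega)]
  have key := core (fun i => (1 / D) • (y i.val - ys)) (fun i => (1 / (L * D)) • gradient g (y i.val))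
    (fun i => (g (y i.val) - g ys) / (L * D ^ 2)) (δ / (L * D ^ 2)) (by positivity)
    (by rw [div_le_iff₀ hLD]; norm_num at h1 ⊢; linarith) ?_ ?_ ?_ ?_ ?_
  · have e : ((15 : Fin 16) : ℕ) = 15 := rfl
    simp only [e] at key
    rw [div_le_iff₀ hLD] at key
    refine key.trans (le_of_eq ?_)
    field_simp
  · intro i
    have hi := i.isLt
    have e0 : ((0 : Fin 16) : ℕ) = 0 := rfl
    simp only [e0]
    rw [hsum i.val (by omega)]
    have : ∑ k : Fin 16, ((if k < i then 1 else 0) * hh k) • (1 / (L * D)) • gradient g (y k.val)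
        = (1 / D) • ∑ k ∈ Finset.range i.val, (h k / L) • gradient g (y k) := by
      rw [Finset.smul_sum]
      have h2 : Finset.range i.val = (Finset.range 16).filter (fun k => k < i.val) := by
        ext k; simp; omega
      rw [h2, Finset.sum_filter,
        ← Fin.sum_univ_eq_sum_range (fun k => if k < i.val then (1 / D) • (h k / L) • gradient g (y k) else 0)]
      refine Finset.sum_congr rfl fun k _ => ?_
      by_cases hk : k < i
      · have hk' : k.val < i.val := hk
        rw [if_pos hk, if_pos hk', hh' k (by omega), smul_smul, smul_smul]
        congr 1
        field_simp
      · have hk' : ¬ k.val < i.val := hk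
        rw [if_neg hk, if_neg hk', zero_mul, zero_smul]
    rw [this, ← smul_sub]
    congr 1
    abel
  · intro i j
    have := interp hL hc hg (y j.val) (y i.val)
    rw [← smul_sub, ← smul_sub, sub_sub_sub_cancel_right, real_inner_smul_left,
      real_inner_smul_right, norm_smul, Real.norm_of_nonneg (by positivity : 0 ≤ 1 / (L * D)),
      le_div_iff₀ hLD]
    refine le_trans (le_of_eq ?_) (sub_le_sub_right this (g ys))
    field_simp
    ring
  · intro j
    have := interp hL hc hg (y j.val) ys
    rw [grad_min hm, zero_sub, norm_neg, ← neg_sub (y j.val) ys, inner_neg_right] at this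
    rw [real_inner_smul_left,
      real_inner_smul_right, norm_smul, Real.norm_of_nonneg (by positivity : 0 ≤ 1 / (L * D))]
    have e : (g (y j.val) - g ys) / (L * D ^ 2)
        - 1 / (L * D) * (1 / D * inner ℝ (gradient g (y j.val)) (y j.val - ys))
        + (1 / (L * D) * ‖gradient g (y j.val)‖) ^ 2 / 2
        = (g (y j.val) + -inner ℝ (gradient g (y j.val)) (y j.val - ys)
          + 1 / (2 * L) * ‖gradient g (y j.val)‖ ^ 2 - g ys) / (L * D ^ 2) := by
      field_simp
      ring
    rw [e]
    exact div_nonpos_of_nonpos_of_nonneg (by linarith) hLD.le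
  · have e0 : ((0 : Fin 16) : ℕ) = 0 := rfl
    simp only [e0]
    rw [norm_smul, Real.norm_of_nonneg (by positivity : 0 ≤ 1 / D), one_div,
      inv_mul_le_iff₀ hD, mul_one]
    exact hy0
  · have e0 : ((0 : Fin 16) : ℕ) = 0 := rfl
    simp only [e0]
    exact div_le_div_of_nonneg_right hgy hLD.le

lemma rate_real (a : ℕ → ℝ) (q S : ℝ) (hS1 : 1 ≤ S) (hS2 : S ≤ 100) (hq : 0 < q)
    (hpos : ∀ m, 0 ≤ a m)
    (h1 : ∀ m, a m ≤ q * 1e-6 → a (m + 1) ≤ a m - S / q * a m ^ 2)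
    (h2 : ∀ m, q * 1e-6 < a m → a (m + 1) ≤ a m - S * 1e-6 * a m) :
    ∃ C : ℝ, 0 ≤ C ∧ ∀ m : ℕ, 0 < m → a m ≤ q / (S * m) + C / (m : ℝ) ^ 2 := by
  have hS0 : 0 < S := by linarith
  have hanti : ∀ m, a (m + 1) ≤ a m := by
    intro m
    rcases le_or_gt (a m) (q * 1e-6) with h | h
    · have := h1 m h
      have : 0 ≤ S / q * a m ^ 2 := by positivity
      linarith
    · have := h2 m h
      have : 0 ≤ S * 1e-6 * a m := mul_nonneg (by positivity) (hpos m)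
      linarith
  have hA : Antitone a := antitone_nat_of_succ_le hanti
  obtain ⟨K, hK⟩ : ∃ K, a K ≤ q * 1e-6 := by
    by_contra! hcon
    have hdec : ∀ m : ℕ, a m ≤ a 0 - m * (q * 1e-12) := by
      intro m
      induction m with
      | zero => simp
      | succ m ih =>
        have e1 := h2 m (hcon m)
        have e2 := hcon m
        push_cast
        have e3 : q * 1e-12 ≤ S * 1e-6 * a m := by
          have : 1 * 1e-6 * (q * 1e-6) ≤ S * 1e-6 * a m := by gcongr
          norm_num at this ⊢
          linarith
        linarith
    obtain ⟨m, hm⟩ := exists_nat_gt (a 0 / (q * 1e-12))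
    rw [div_lt_iff₀ (by positivity)] at hm
    linarith [hdec m, hpos m]
  have hj : ∀ j : ℕ, a (K + j) * (S * j) ≤ q := by
    intro j
    induction j with
    | zero => simp; exact hq.le
    | succ j ih =>
      have hs : a (K + j) ≤ q * 1e-6 := (hA (Nat.le_add_right K j)).trans hK
      have e1 := h1 (K + j) hs
      rw [← add_assoc]
      have hb : ∃ b, a (K + j) = q * b / S := ⟨S * a (K + j) / q, by field_simp⟩
      obtain ⟨b, hb⟩ := hb
      have hb0 : 0 ≤ b := by
        have := hpos (K + j)
        rw [hb] at this
        by_contra hneg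
        push Not at hneg
        have : q * b / S < 0 := div_neg_of_neg_of_pos (mul_neg_of_pos_of_neg hq hneg) hS0
        linarith
      have hb1 : b ≤ 1 := by
        rw [hb, div_le_iff₀ hS0, mul_assoc] at hs
        have := le_of_mul_le_mul_left hs hq
        norm_num at this
        linarith
      have hbj : b * j ≤ 1 := by
        rw [hb] at ih
        have e : q * b / S * (S * j) = q * (b * j) := by field_simp
        rw [e] at ih
        exact le_of_mul_le_mul_left (by linarith) hq
      have e2 : a (K + j + 1) ≤ q * (b - b ^ 2) / S := by
        refine e1.trans (le_of_eq ?_)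
        rw [hb]
        field_simp
      push_cast
      calc a (K + j + 1) * (S * ((j : ℝ) + 1))
          ≤ q * (b - b ^ 2) / S * (S * ((j : ℝ) + 1)) :=
            mul_le_mul_of_nonneg_right e2 (by positivity)
        _ = q * ((1 - b) * (b * j + b)) := by field_simp
        _ ≤ q * 1 := by
            refine mul_le_mul_of_nonneg_left ?_ hq.le
            nlinarith [mul_le_mul_of_nonneg_left hbj (by linarith : 0 ≤ 1 - b)]
        _ = q := mul_one q
  refine ⟨q * K * (K + 1) / S + a 0 * K ^ 2, ?_, ?_⟩
  · have := hpos 0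
    positivity
  · intro m hm
    have hm' : (0 : ℝ) < m := by exact_mod_cast hm
    have h00 := hpos 0
    rcases le_or_gt m K with h | h
    · have hmk : (m : ℝ) ≤ K := by exact_mod_cast h
      have e1 : a m ≤ a 0 := hA (Nat.zero_le m)
      have e2 : a 0 ≤ (q * K * (K + 1) / S + a 0 * K ^ 2) / (m : ℝ) ^ 2 := by
        rw [le_div_iff₀ (by positivity)]
        have : a 0 * (m : ℝ) ^ 2 ≤ a 0 * (K : ℝ) ^ 2 := by gcongr
        have : 0 ≤ q * K * (K + 1) / S := by positivity
        linarith
      have : 0 ≤ q / (S * m) := by positivity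
      linarith
    · obtain ⟨j, rfl⟩ := Nat.exists_eq_add_of_lt h
      have e1 := hj (j + 1)
      rw [← add_assoc] at e1
      push_cast at e1 ⊢
      set t : ℝ := (j : ℝ) + 1 with ht
      have ht1 : 1 ≤ t := by rw [ht]; linarith [Nat.cast_nonneg (α := ℝ) j]
      have hk0 : (0 : ℝ) ≤ K := Nat.cast_nonneg K
      have ekt : (K : ℝ) + j + 1 = K + t := by rw [ht]; ring
      rw [ekt]
      have e2 : a (K + j + 1) ≤ q / (S * t) := by
        rw [le_div_iff₀ (by positivity)]; exact e1
      have e3 : q / (S * t) = q / (S * (K + t)) + q * K / (S * (t * (K + t))) := by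
        field_simp
        ring
      have e4 : q * K / (S * (t * (K + t))) ≤ q * K * (K + 1) / S / (K + t) ^ 2 := by
        rw [div_div, div_le_div_iff₀ (by positivity) (by positivity)]
        have : (K : ℝ) + t ≤ (K + 1) * t := by nlinarith
        calc q * K * (S * (K + t) ^ 2) = q * K * S * (K + t) * (K + t) := by ring
          _ ≤ q * K * S * (K + t) * ((K + 1) * t) := by gcongr
          _ = _ := by ring
      have e5 : q * K * (K + 1) / S / (K + t) ^ 2
          ≤ (q * K * (K + 1) / S + a 0 * K ^ 2) / (K + t) ^ 2 := by
        gcongr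
        have : 0 ≤ a 0 * (K : ℝ) ^ 2 := by positivity
        linarith
      linarith

lemma rate_main (h : ℕ → ℝ) (hh' : ∀ k : Fin 16, k.val < 15 → hh k = h k.val)
    (n : ℕ) (L : ℝ) (hL : 0 < L) (f : E n → ℝ) (hc : ConvexOn ℝ Set.univ f)
    (hf : IsLSmooth L f) (xs : E n) (hm : ∀ z, f xs ≤ f z) (x : ℕ → E n) (D : ℝ)
    (hD : ∀ z, f z ≤ f (x 0) → ‖z - xs‖ ≤ D)
    (hx : ∀ k : ℕ, x (k + 1) = x k - (h (k % 15) / L) • gradient f (x k)) :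
    ∃ C : ℝ, 0 ≤ C ∧ ∀ m : ℕ, 0 < m →
      f (x (15 * m)) - f xs ≤ L * D ^ 2 / (579 / 10 * m) + C / (m : ℝ) ^ 2 := by
  have hD0 : 0 ≤ D := (norm_nonneg _).trans (hD (x 0) le_rfl)
  rcases hD0.eq_or_lt with h0 | hpos
  · have hx0 : x 0 = xs := by
      have := hD (x 0) le_rfl
      rw [← h0] at this
      exact sub_eq_zero.mp (norm_le_zero_iff.mp this)
    have hk : ∀ k, x k = xs := by
      intro k
      induction k with
      | zero => exact hx0
      | succ k ih => rw [hx k, ih, grad_min hm, smul_zero, sub_zero]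
    refine ⟨0, le_rfl, fun m _ => ?_⟩
    rw [hk, sub_self, zero_div, add_zero]
    positivity
  · have hq : 0 < L * D ^ 2 := by positivity
    have block : ∀ m (D' δ : ℝ), 0 < D' → 0 ≤ δ → δ ≤ L * D' ^ 2 * 1e-6 →
        ‖x (15 * m) - xs‖ ≤ D' → f (x (15 * m)) - f xs ≤ δ →
        f (x (15 * (m + 1))) - f xs ≤ δ - 579 / 10 / (L * D' ^ 2) * δ ^ 2 := by
      intro m D' δ hD' hδ hδ1 hn hv
      refine straight0 h hh' n L D' δ hL hD' hδ hδ1 f hc hf xs hm (fun k => x (15 * m + k))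
        hn hv ?_
      intro k hk
      have := hx (15 * m + k)
      rw [Nat.mul_add_mod, Nat.mod_eq_of_lt hk] at this
      exact this
    have hnn : ∀ m, 0 ≤ f (x (15 * m)) - f xs := fun m => sub_nonneg.mpr (hm _)
    have st1 : ∀ m, f (x (15 * m)) ≤ f (x 0) → f (x (15 * m)) - f xs ≤ L * D ^ 2 * 1e-6 →
        f (x (15 * (m + 1))) - f xs ≤ f (x (15 * m)) - f xs
          - 579 / 10 / (L * D ^ 2) * (f (x (15 * m)) - f xs) ^ 2 := fun m h1 h2 =>
      block m D _ hpos (hnn m) h2 (hD _ h1) le_rfl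
    have st2 : ∀ m, f (x (15 * m)) ≤ f (x 0) → L * D ^ 2 * 1e-6 < f (x (15 * m)) - f xs →
        f (x (15 * (m + 1))) - f xs ≤ f (x (15 * m)) - f xs
          - 579 / 10 * 1e-6 * (f (x (15 * m)) - f xs) := by
      intro m h1 h2
      have hb := block m
      set v := f (x (15 * m)) - f xs with hv
      have hv0 : 0 < v := lt_trans (by positivity) h2
      have hs : Real.sqrt (v / (L * 1e-6)) ^ 2 = v / (L * 1e-6) := Real.sq_sqrt (by positivity)
      have hDD : D ≤ Real.sqrt (v / (L * 1e-6)) := by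
        apply Real.le_sqrt_of_sq_le
        rw [le_div_iff₀ (by positivity)]
        linarith
      have e : L * Real.sqrt (v / (L * 1e-6)) ^ 2 = v / 1e-6 := by
        rw [hs]; field_simp
      have hr := hb (Real.sqrt (v / (L * 1e-6))) v (lt_of_lt_of_le hpos hDD) hv0.le
        (by rw [e]; apply le_of_eq; field_simp) ((hD _ h1).trans hDD) le_rfl
      rw [e] at hr
      refine hr.trans (le_of_eq ?_)
      congr 1
      field_simp
    have mono : ∀ m, f (x (15 * m)) ≤ f (x 0) := by
      intro m
      induction m with
      | zero => exact le_rfl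
      | succ m ih =>
        have h3 := hnn m
        rcases le_or_gt (f (x (15 * m)) - f xs) (L * D ^ 2 * 1e-6) with h | h
        · have := st1 m ih h
          have : 0 ≤ 579 / 10 / (L * D ^ 2) * (f (x (15 * m)) - f xs) ^ 2 := by positivity
          linarith
        · have := st2 m ih h
          have : 0 ≤ 579 / 10 * 1e-6 * (f (x (15 * m)) - f xs) :=
            mul_nonneg (by positivity) h3
          linarith
    exact rate_real (fun m => f (x (15 * m)) - f xs) (L * D ^ 2) (579 / 10) (by norm_num)
      (by norm_num) hq hnn (fun m => st1 m (mono m)) (fun m => st2 m (mono m))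

/-- Theorem 3.6 (case `t = 15`): the pattern
`h = (7/5, 2, 7/5, 9/2, 7/5, 2, 7/5, 297/10, 7/5, 2, 7/5, 9/2, 7/5, 2, 7/5)`
is `10⁻⁹`-straightforward with parameter `Δ = 10⁻⁶`; consequently gradient descent cycling
through these stepsizes over `L` satisfies
`f (x T) - f x⋆ ≤ L D² / ((193/50 - 10⁻⁹) T) + C/T²` for all `T > 0` divisible by `15`. -/
theorem fifteen_step_pattern_rate
    (h : ℕ → ℝ)
    (hdef : h = fun k =>
      if k % 15 = 7 then 297 / 10
      else if k % 15 = 3 ∨ k % 15 = 11 then 9 / 2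
      else if k % 15 % 2 = 1 then 2
      else 7 / 5) :
    IsStraightforward 15 h (1e-9) (1e-6)
    ∧ (∀ (n : ℕ) (L : ℝ), 0 < L →
        ∀ f : E n → ℝ, ConvexOn ℝ Set.univ f → IsLSmooth L f →
          ∀ xstar : E n, (∀ z, f xstar ≤ f z) →
            ∀ (x : ℕ → E n) (x0 : E n), x 0 = x0 →
              ∀ D : ℝ, IsLUB {r : ℝ | ∃ z : E n, f z ≤ f x0 ∧ r = ‖z - xstar‖} D →
                (∀ k : ℕ, x (k + 1) = x k - (h (k % 15) / L) • gradient f (x k)) →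
                ∃ C : ℝ, 0 ≤ C ∧ ∀ T : ℕ, 0 < T → 15 ∣ T →
                  f (x T) - f xstar ≤
                    L * D ^ 2 / ((193 / 50 - 1e-9) * T) + C / (T : ℝ) ^ 2) := by
  have hh' : ∀ k : Fin 16, k.val < 15 → hh k = h k.val := by
    intro k hk
    rw [hh_eq k hk, hdef]
  constructor
  · intro n L D δ hL hD h0 h1 g hc hg ys hm y hy0 hgy hy
    refine (straight0 h hh' n L D δ hL hD h0 h1 g hc hg ys hm y hy0 hgy hy).trans ?_
    have hs : ∑ i ∈ Finset.range 15, (h i - 1e-9) ≤ 579 / 10 := by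
      rw [hdef]
      norm_num [Finset.sum_range_succ]
    have hLD : 0 < L * D ^ 2 := by positivity
    gcongr
  · intro n L hL f hc hf xs hm x x0 hx0 D hD hx
    subst hx0
    obtain ⟨C, hC, hr⟩ := rate_main h hh' n L hL f hc hf xs hm x D
      (fun z hz => hD.1 ⟨z, hz, rfl⟩) hx
    refine ⟨225 * C, by positivity, ?_⟩
    rintro T hT ⟨m, rfl⟩
    have hm0 : 0 < m := by omega
    have hmr : (0 : ℝ) < m := by exact_mod_cast hm0
    refine (hr m hm0).trans ?_
    push_cast
    have e : 225 * C / (15 * (m : ℝ)) ^ 2 = C / (m : ℝ) ^ 2 := by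
      field_simp
      ring
    rw [e]
    have h3 : (193 / 50 - 1e-9) * (15 * (m : ℝ)) ≤ 579 / 10 * m := by
      norm_num
      linarith
    have h4 : 0 < (193 / 50 - 1e-9) * (15 * (m : ℝ)) := by
      norm_num
      exact hm0
    gcongr

end
end
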